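/- arXiv:2309.17181 — 9 statements merged into one kernel-verified Lean document; each statement's English description precedes it below -/
import Mathlib

section
/- Let k be a natural number and let z, y, c be complex numbers with c ≠ 0, c^i ≠ 1 for all 1 ≤ i ≤ k, and z·c^m ≠ 1 for all integers 0 ≤ m ≤ 2k−1. Then Σ_{j=0}^{k} (−1)^j z^j c^{3j(j−1)/2} · [(c;c)_k / ((c;c)_{k−j}·(c;c)_j)] · [(y c^{1−j};c)_j / (z c^{j−1};c)_j] · [(z y c^{j};c)_{k−j} / (z c^{2j};c)_{k−j}] = 1. (Lemma 5.2.1, a q-binomial identity generalizing (1−z)^k = Σ_j (−1)^j C(k,j)(z−zy)^j(1−zy)^{k−j}.) -/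
open Finset

/-- The q-Pochhammer symbol `(x;c)_m = ∏_{i=0}^{m-1} (1 - c^i x)`. -/
noncomputable def qPoch (x c : ℂ) (m : ℕ) : ℂ := ∏ i ∈ Finset.range m, (1 - c ^ i * x)

/-- The summand. -/
noncomputable def qTerm (z y c : ℂ) (k j : ℕ) : ℂ :=
  (-1 : ℂ) ^ j * z ^ j * c ^ (3 * (j * (j - 1) / 2)) *
        (qPoch c c k / (qPoch c c (k - j) * qPoch c c j)) *
        (qPoch (y * c ^ ((1 : ℤ) - (j : ℤ))) c j / qPoch (z * c ^ ((j : ℤ) - 1)) c j) *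
        (qPoch (z * y * c ^ j) c (k - j) / qPoch (z * c ^ (2 * j)) c (k - j))

noncomputable def qE (c : ℂ) (j : ℕ) : ℂ := ∏ i ∈ Finset.range j, c ^ i
noncomputable def qW (y c : ℂ) (j : ℕ) : ℂ := ∏ i ∈ Finset.range j, (c ^ i - y)

/-- WZ mate. -/
noncomputable def qMate (z y c : ℂ) (k j : ℕ) : ℂ :=
  (-1 : ℂ) ^ j * z ^ j * qE c j ^ 2 * qW y c j *
        (qPoch c c k / (qPoch c c (k - j) * qPoch c c j)) *
        qPoch (z * y * c ^ j) c (k - j) / qPoch (z * c ^ j) c (k + 1) *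
        (z * c ^ k * c ^ j * (c ^ j - y))

lemma qPoch_succ (x c : ℂ) (m : ℕ) : qPoch x c (m + 1) = qPoch x c m * (1 - c ^ m * x) := by
  simp [qPoch, Finset.prod_range_succ]

lemma qPoch_zero (x c : ℂ) : qPoch x c 0 = 1 := by simp [qPoch]

lemma qPoch_add (x c : ℂ) (m n : ℕ) :
    qPoch x c (m + n) = qPoch x c m * qPoch (x * c ^ m) c n := by
  unfold qPoch
  rw [Finset.prod_range_add]
  congr 1
  apply Finset.prod_congr rfl
  intro i _
  ring

lemma qPoch_ne (x c : ℂ) (m : ℕ) (h : ∀ i < m, c ^ i * x ≠ 1) : qPoch x c m ≠ 0 := by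
  unfold qPoch
  rw [Finset.prod_ne_zero_iff]
  intro i hi h0
  exact h i (Finset.mem_range.1 hi) (sub_eq_zero.1 h0).symm

lemma qE_pow (c : ℂ) (j : ℕ) : c ^ (j * (j - 1) / 2) = qE c j := by
  rw [qE, Finset.prod_pow_eq_pow_sum, Finset.sum_range_id]

lemma qE_mul (y c : ℂ) (hc : c ≠ 0) (j : ℕ) :
    qE c j * qPoch (y * c ^ ((1 : ℤ) - (j : ℤ))) c j = qW y c j := by
  unfold qPoch
  rw [← Finset.prod_range_reflect, qE, qW, ← Finset.prod_mul_distrib]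
  apply Finset.prod_congr rfl
  intro i hi
  have hi := Finset.mem_range.1 hi
  have h : c ^ i * (c ^ (j - 1 - i) * c ^ ((1 : ℤ) - (j : ℤ))) = 1 := by
    rw [← zpow_natCast, ← zpow_natCast, ← zpow_add₀ hc, ← zpow_add₀ hc]
    have : ((i : ℤ) + (((j - 1 - i : ℕ) : ℤ) + (1 - (j : ℤ)))) = 0 := by omega
    rw [this, zpow_zero]
  linear_combination (-y) * h

lemma qTerm_eq (z y c : ℂ) (hc : c ≠ 0) (k j : ℕ) : qTerm z y c k j =
    (-1 : ℂ) ^ j * z ^ j * qE c j ^ 2 * qW y c j *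
        (qPoch c c k / (qPoch c c (k - j) * qPoch c c j)) /
        qPoch (z * c ^ ((j : ℤ) - 1)) c j *
        (qPoch (z * y * c ^ j) c (k - j) / qPoch (z * c ^ (2 * j)) c (k - j)) := by
  rw [qTerm, ← qE_mul y c hc, mul_comm 3, pow_mul, qE_pow]
  ring

lemma qStep_zero (k : ℕ) (z y c : ℂ) (hc : c ≠ 0)
    (hc1 : ∀ i : ℕ, 1 ≤ i → i ≤ k + 1 → c ^ i ≠ 1)
    (hz : ∀ m : ℕ, m ≤ 2 * k + 1 → z * c ^ m ≠ 1) :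
    qTerm z y c (k + 1) 0 - qTerm z y c k 0 = qMate z y c k 0 := by
  have h1 : qPoch c c (k + 1) ≠ 0 := qPoch_ne _ _ _ fun i hi => by
    rw [← pow_succ]; exact hc1 _ (by omega) (by omega)
  have h1' : qPoch c c k ≠ 0 := by rw [qPoch_succ] at h1; exact left_ne_zero_of_mul h1
  have h2 : qPoch z c (k + 1) ≠ 0 := qPoch_ne _ _ _ fun i hi => by
    rw [mul_comm]; exact hz _ (by omega)
  simp only [qTerm, qMate, qE, qW]
  simp [qPoch_zero, div_self h1, div_self h1']
  rw [qPoch_succ] at h2 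
  rw [qPoch_succ, qPoch_succ]
  have h3 := left_ne_zero_of_mul h2
  have h4 := right_ne_zero_of_mul h2
  generalize hu : 1 - c ^ k * z = u at h4 ⊢
  field_simp
  subst hu
  ring

lemma qStep_succ (j d : ℕ) (z y c : ℂ) (hc : c ≠ 0)
    (hc1 : ∀ i : ℕ, 1 ≤ i → i ≤ j + 1 + d + 1 → c ^ i ≠ 1)
    (hz : ∀ m : ℕ, m ≤ 2 * (j + 1 + d) + 1 → z * c ^ m ≠ 1) :
    qTerm z y c (j + 1 + d + 1) (j + 1) - qTerm z y c (j + 1 + d) (j + 1)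
      = qMate z y c (j + 1 + d) (j + 1) - qMate z y c (j + 1 + d) j := by
  have hP : ∀ n ≤ j + 1 + d + 1, qPoch c c n ≠ 0 := fun n hn => qPoch_ne _ _ _ fun i hi => by
    rw [← pow_succ]; exact hc1 _ (by omega) (by omega)
  have hQ : ∀ a n : ℕ, a + n ≤ 2 * (j + 1 + d) + 2 → qPoch (z * c ^ a) c n ≠ 0 :=
    fun a n hn => qPoch_ne _ _ _ fun i hi => by
      have := hz (a + i) (by omega)
      rw [pow_add] at this
      intro h; apply this; rw [← h]; ring
  have hx : ∀ n : ℕ, n ≤ 2 * (j + 1 + d) + 1 → 1 - z * c ^ n ≠ 0 := fun n hn h =>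
    hz n hn (sub_eq_zero.1 h).symm
  have hy : ∀ n : ℕ, n ≤ j + 1 + d → 1 - c ^ (n + 1) ≠ 0 := fun n hn h =>
    hc1 (n + 1) (by omega) (by omega) (sub_eq_zero.1 h).symm
  rw [qTerm_eq _ _ _ hc, qTerm_eq _ _ _ hc, qMate, qMate]
  have e1 : j + 1 + d + 1 - (j + 1) = d + 1 := by omega
  have e2 : j + 1 + d - (j + 1) = d := by omega
  have e3 : j + 1 + d - j = d + 1 := by omega
  have e4 : ((j + 1 : ℕ) : ℤ) - 1 = (j : ℤ) := by push_cast; ring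
  rw [e1, e2, e3, e4, zpow_natCast]
  have f1 : qPoch (z * c ^ j) c (j + 1) = (1 - z * c ^ j) * qPoch (z * c ^ (j + 1)) c j := by
    rw [add_comm, qPoch_add, qPoch_succ, qPoch_zero]; ring_nf
  have f2 : qPoch (z * c ^ j) c (j + 1 + d + 1) = (1 - z * c ^ j) *
      qPoch (z * c ^ (j + 1)) c j * (1 - z * c ^ (2 * j + 1)) *
      qPoch (z * c ^ (2 * (j + 1))) c d := by
    rw [show j + 1 + d + 1 = (j + 1) + (1 + d) by ring, qPoch_add, f1, qPoch_add, qPoch_succ,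
      qPoch_zero]; ring_nf
  have f3 : qPoch (z * c ^ (j + 1)) c (j + 1 + d + 1) =
      qPoch (z * c ^ (j + 1)) c j * (1 - z * c ^ (2 * j + 1)) *
      qPoch (z * c ^ (2 * (j + 1))) c d * (1 - z * c ^ (2 * j + 2 + d)) := by
    rw [show j + 1 + d + 1 = j + (1 + (d + 1)) by ring, qPoch_add, qPoch_add, qPoch_succ,
      qPoch_zero, qPoch_succ]; ring_nf
  have f4 : qPoch (z * c ^ (2 * (j + 1))) c (d + 1) =
      qPoch (z * c ^ (2 * (j + 1))) c d * (1 - z * c ^ (2 * j + 2 + d)) := by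
    rw [qPoch_succ]; ring_nf
  have f5 : qPoch (z * y * c ^ (j + 1)) c (d + 1) =
      qPoch (z * y * c ^ (j + 1)) c d * (1 - z * y * c ^ (j + 1 + d)) := by
    rw [qPoch_succ]; ring_nf
  have f6 : qPoch (z * y * c ^ j) c (d + 1) =
      (1 - z * y * c ^ j) * qPoch (z * y * c ^ (j + 1)) c d := by
    rw [add_comm d, qPoch_add, qPoch_succ, qPoch_zero]; ring_nf
  have f7 : ∀ n, qPoch c c (n + 1) = qPoch c c n * (1 - c ^ (n + 1)) := fun n => by
    rw [qPoch_succ, pow_succ]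
  have g1 : qE c (j + 1) = qE c j * c ^ j := by simp [qE, Finset.prod_range_succ]
  have g2 : qW y c (j + 1) = qW y c j * (c ^ j - y) := by simp [qW, Finset.prod_range_succ]
  rw [f2, f3, f1, f4, f5, f6, f7 (j + 1 + d), f7 d, f7 j, g1, g2]
  have n1 := hx j (by omega)
  have n2 := hx (2 * j + 1) (by omega)
  have n3 := hx (2 * j + 2 + d) (by omega)
  have n4 := hQ (j + 1) j (by omega)
  have n5 := hQ (2 * (j + 1)) d (by omega)
  have n6 := hP j (by omega)
  have n7 := hP d (by omega)
  have n8 := hy j (by omega)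
  have n9 := hy d (by omega)
  have p1 : c ^ (2 * j + 1) = (c ^ j) ^ 2 * c := by ring
  have p2 : c ^ (2 * j + 2 + d) = (c ^ j) ^ 2 * c ^ 2 * c ^ d := by ring
  have p3 : c ^ (j + 1) = c ^ j * c := by ring
  have p4 : c ^ (d + 1) = c ^ d * c := by ring
  have p5 : c ^ (j + 1 + d) = c ^ j * c * c ^ d := by ring
  have p6 : c ^ (j + 1 + d + 1) = c ^ j * c ^ 2 * c ^ d := by ring
  generalize qPoch (z * c ^ (j + 1)) c j = C at *
  generalize qPoch (z * c ^ (2 * (j + 1))) c d = B at *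
  generalize qPoch (z * y * c ^ (j + 1)) c d = A at *
  generalize qPoch c c (j + 1 + d) = P at *
  generalize qPoch c c j = R at *
  generalize qPoch c c d = S at *
  generalize qE c j = E at *
  generalize qW y c j = W at *
  clear f1 f2 f3 f4 f5 f6 f7 g1 g2 hP hQ hx hy hz hc1
  rw [p1] at n2 ⊢
  rw [p2] at n3 ⊢
  rw [p3] at n8
  rw [p4] at n9
  rw [p6, p5, p4, p3, pow_succ (-1 : ℂ) j, pow_succ z j]
  generalize (-1 : ℂ) ^ j = s at *
  generalize z ^ j = t at *
  generalize c ^ j = x at *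
  generalize c ^ d = D at *
  generalize hu1 : 1 - z * x = u1 at n1 ⊢
  generalize hu2 : 1 - z * (x ^ 2 * c) = u2 at n2 ⊢
  generalize hu3 : 1 - z * (x ^ 2 * c ^ 2 * D) = u3 at n3 ⊢
  generalize hu4 : 1 - x * c = u4 at n8 ⊢
  generalize hu5 : 1 - D * c = u5 at n9 ⊢
  field_simp
  subst hu1 hu2 hu3 hu4 hu5
  ring

lemma qStep_last (k : ℕ) (z y c : ℂ) (hc : c ≠ 0)
    (hc1 : ∀ i : ℕ, 1 ≤ i → i ≤ k + 1 → c ^ i ≠ 1) :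
    qTerm z y c (k + 1) (k + 1) + qMate z y c k k = 0 := by
  have hP : ∀ n ≤ k + 1, qPoch c c n ≠ 0 := fun n hn => qPoch_ne _ _ _ fun i hi => by
    rw [← pow_succ]; exact hc1 _ (by omega) (by omega)
  have e4 : ((k + 1 : ℕ) : ℤ) - 1 = (k : ℤ) := by push_cast; ring
  have g1 : qE c (k + 1) = qE c k * c ^ k := by simp [qE, Finset.prod_range_succ]
  have g2 : qW y c (k + 1) = qW y c k * (c ^ k - y) := by simp [qW, Finset.prod_range_succ]
  rw [qTerm_eq _ _ _ hc, qMate, e4, zpow_natCast, g1, g2]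
  simp only [Nat.sub_self, qPoch_zero, one_mul, div_self (hP k (by omega)),
    div_self (hP (k + 1) le_rfl)]
  ring

lemma qPartial (k : ℕ) (z y c : ℂ) (hc : c ≠ 0)
    (hc1 : ∀ i : ℕ, 1 ≤ i → i ≤ k + 1 → c ^ i ≠ 1)
    (hz : ∀ m : ℕ, m ≤ 2 * k + 1 → z * c ^ m ≠ 1) (m : ℕ) (hm : m ≤ k) :
    ∑ j ∈ Finset.range (m + 1), (qTerm z y c (k + 1) j - qTerm z y c k j) = qMate z y c k m := by
  induction m with
  | zero => simpa using qStep_zero k z y c hc hc1 hz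
  | succ m ih =>
    rw [Finset.sum_range_succ, ih (by omega)]
    obtain ⟨d, rfl⟩ := Nat.exists_eq_add_of_le hm
    rw [qStep_succ m d z y c hc hc1 hz]
    ring

lemma qMain (k : ℕ) (z y c : ℂ) (hc : c ≠ 0)
    (hc1 : ∀ i : ℕ, 1 ≤ i → i ≤ k → c ^ i ≠ 1)
    (hz : ∀ m : ℕ, m + 1 ≤ 2 * k → z * c ^ m ≠ 1) :
    ∑ j ∈ Finset.range (k + 1), qTerm z y c k j = 1 := by
  induction k with
  | zero => simp [qTerm, qPoch_zero]
  | succ k ih =>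
    have h := ih (fun i h1 h2 => hc1 i h1 (by omega)) (fun m hm => hz m (by omega))
    have h2 := qPartial k z y c hc hc1 (fun m hm => hz m (by omega)) k le_rfl
    have h3 := qStep_last k z y c hc hc1
    rw [Finset.sum_sub_distrib] at h2
    rw [Finset.sum_range_succ]
    linear_combination h + h2 + h3

/-- Lemma 5.2.1: a q-binomial identity generalizing
`(1−z)^k = Σ_j (−1)^j C(k,j)(z−zy)^j(1−zy)^{k−j}`. -/
theorem qBinomialLemma (k : ℕ) (z y c : ℂ) (hc : c ≠ 0)
    (hc1 : ∀ i : ℕ, 1 ≤ i → i ≤ k → c ^ i ≠ 1)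
    (hz : ∀ m : ℤ, 0 ≤ m → m ≤ 2 * (k : ℤ) - 1 → z * c ^ m ≠ 1) :
    ∑ j ∈ Finset.range (k + 1),
      (-1 : ℂ) ^ j * z ^ j * c ^ (3 * (j * (j - 1) / 2)) *
        (qPoch c c k / (qPoch c c (k - j) * qPoch c c j)) *
        (qPoch (y * c ^ ((1 : ℤ) - (j : ℤ))) c j / qPoch (z * c ^ ((j : ℤ) - 1)) c j) *
        (qPoch (z * y * c ^ j) c (k - j) / qPoch (z * c ^ (2 * j)) c (k - j)) = 1 := by
  refine qMain k z y c hc hc1 fun m hm => ?_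
  have := hz m (by omega) (by omega)
  rwa [zpow_natCast] at this
end

section
/- Kadell's lemma: let n ≥ 1, let Q ∈ ℂ with Q ≠ 1, and let J ⊆ {1,…,n}. Then, as an identity of polynomials in t₁,…,t_n, Σ_{σ ∈ S_n} sgn(σ) · ∏_{j∈J} t_{σ(j)} · ∏_{1≤i<j≤n} (t_{σ(i)} − Q t_{σ(j)}) = Q^{e(J)} · [(Q;Q)_{|J|} (Q;Q)_{n−|J|} / (1−Q)^n] · e_{|J|}(t) · ∏_{1≤i<j≤n} (t_i − t_j), where |J| = #J and e(J) := #{(i,j) : 1 ≤ i < j ≤ n, i ∉ J, j ∈ J}. -/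
open Finset

open Polynomial in
lemma kad_key (n : ℕ) (Q : ℂ) (t : Fin (n+1) → ℂ) (ht : Function.Injective t) :
    C (1 - Q) * X * ∑ k : Fin (n+1),
      C (∏ i : Fin n, ((t k - Q * t (Equiv.swap 0 k i.succ)) / (t k - t (Equiv.swap 0 k i.succ)))) *
        ∏ i : Fin n, (X + C (t (Equiv.swap 0 k i.succ)))
    = ∏ i, (X + C (Q * t i)) - C (Q ^ (n+1)) * ∏ i, (X + C (t i)) := by
  have hsplit : ∀ (k : Fin (n+1)) (f : Fin (n+1) → ℂ[X]),
      ∏ i, f i = f k * ∏ i : Fin n, f (Equiv.swap 0 k i.succ) := by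
    intro k f
    rw [← Equiv.prod_comp (Equiv.swap 0 k) f, Fin.prod_univ_succ, Equiv.swap_apply_left]
  have hne : ∀ (k : Fin (n+1)) (i : Fin n), t k - t (Equiv.swap 0 k i.succ) ≠ 0 := by
    intro k i h
    have h1 := ht (sub_eq_zero.1 h)
    have h2 : Equiv.swap 0 k 0 = Equiv.swap 0 k i.succ := by
      rw [Equiv.swap_apply_left]; exact h1
    exact (Fin.succ_ne_zero i).symm ((Equiv.swap 0 k).injective h2)
  set N : ℂ[X] := ∏ i, (X + C (Q * t i)) - C (Q ^ (n+1)) * ∏ i, (X + C (t i)) with hN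
  have hN0 : N.coeff 0 = 0 := by
    rw [coeff_zero_eq_eval_zero, hN]
    simp [eval_prod, Finset.prod_mul_distrib]
  have hXR : X * N.divX = N := by
    have := X_mul_divX_add N
    rw [hN0, C_0, add_zero] at this
    exact this
  have hmd : ∀ (m : ℕ) (s : Fin m → ℂ), (∏ i, (X + C (s i))).natDegree ≤ m := by
    intro m s
    refine (natDegree_prod_le _ _).trans ?_
    simp
  have hdN : N.natDegree ≤ n + 1 := by
    refine (natDegree_sub_le _ _).trans (max_le (hmd _ _) ?_)
    exact (natDegree_C_mul_le _ _).trans (hmd _ _)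
  have hdR : N.divX.natDegree ≤ n := by
    rw [natDegree_divX_eq_natDegree_tsub_one]; omega
  suffices h : C (1 - Q) * ∑ k : Fin (n+1),
      C (∏ i : Fin n, ((t k - Q * t (Equiv.swap 0 k i.succ)) / (t k - t (Equiv.swap 0 k i.succ)))) *
        ∏ i : Fin n, (X + C (t (Equiv.swap 0 k i.succ))) = N.divX by
    rw [← hXR, ← h]; ring
  have hdL : (C (1 - Q) * ∑ k : Fin (n+1),
      C (∏ i : Fin n, ((t k - Q * t (Equiv.swap 0 k i.succ)) / (t k - t (Equiv.swap 0 k i.succ)))) *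
        ∏ i : Fin n, (X + C (t (Equiv.swap 0 k i.succ)))).natDegree ≤ n := by
    refine (natDegree_C_mul_le _ _).trans ?_
    refine natDegree_sum_le_of_forall_le _ _ ?_
    intro k _
    exact (natDegree_C_mul_le _ _).trans (hmd _ _)
  refine eq_of_degrees_lt_of_eval_index_eq (s := (Finset.univ : Finset (Fin (n+1)))) (v := fun k => - t k) ?_ ?_ ?_ ?_
  · intro a _ b _ h
    exact ht (neg_injective h)
  · refine lt_of_le_of_lt (degree_le_of_natDegree_le hdL) ?_
    simp only [Finset.card_univ, Fintype.card_fin]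
    exact_mod_cast Nat.lt_succ_self n
  · refine lt_of_le_of_lt (degree_le_of_natDegree_le hdR) ?_
    simp only [Finset.card_univ, Fintype.card_fin]
    exact_mod_cast Nat.lt_succ_self n
  · intro k _
    have hR : N.divX.eval (- t k) = (1 - Q) * ∏ i : Fin n, (- t k + Q * t (Equiv.swap 0 k i.succ)) := by
      have hN2 : X * N.divX = (X + C (Q * t k)) * ∏ i : Fin n, (X + C (Q * t (Equiv.swap 0 k i.succ)))
          - C (Q^(n+1)) * ((X + C (t k)) * ∏ i : Fin n, (X + C (t (Equiv.swap 0 k i.succ)))) := by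
        rw [hXR, hN, hsplit k, hsplit k (fun i => X + C (t i))]
      by_cases hk : t k = 0
      · simp only [hk, mul_zero, C_0, add_zero] at hN2 ⊢
        have h3 : N.divX = ∏ i : Fin n, (X + C (Q * t (Equiv.swap 0 k i.succ)))
          - C (Q^(n+1)) * ∏ i : Fin n, (X + C (t (Equiv.swap 0 k i.succ))) := by
          apply mul_left_cancel₀ (X_ne_zero (R := ℂ))
          rw [hN2]; ring
        rw [h3]
        simp [eval_prod, Finset.prod_mul_distrib]
        ring
      · have h4 := congrArg (eval (- t k)) hN2
        simp [eval_prod] at h4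
        apply mul_left_cancel₀ (neg_ne_zero.2 hk)
        rw [neg_mul, h4]; ring
    rw [hR]
    simp only [eval_mul, eval_C, eval_finsetSum, eval_prod, eval_add, eval_X]
    congr 1
    rw [Finset.sum_eq_single k]
    · rw [← Finset.prod_mul_distrib]
      refine Finset.prod_congr rfl fun i _ => ?_
      have := hne k i
      field_simp
      ring
    · intro j _ hj
      apply mul_eq_zero_of_right
      have h5 : Equiv.swap 0 j k ≠ 0 := by
        intro h
        apply hj
        have := congrArg (Equiv.swap 0 j) h
        simpa using this.symm
      obtain ⟨i, hi⟩ := Fin.exists_succ_eq.2 h5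
      refine Finset.prod_eq_zero (Finset.mem_univ i) ?_
      rw [hi]; simp
    · simp

noncomputable def kadE (n m : ℕ) (t : Fin n → ℂ) : ℂ :=
  ∑ S ∈ Finset.powersetCard m (Finset.univ : Finset (Fin n)), ∏ i ∈ S, t i

open Polynomial in
lemma kadE_coeff (n m : ℕ) (hm : m ≤ n) (t : Fin n → ℂ) :
    (∏ i, (X + C (t i))).coeff (n - m) = kadE n m t := by
  rw [Finset.prod_X_add_C_coeff _ _ (by simp)]
  simp only [Finset.card_univ, Fintype.card_fin, kadE]
  congr 2
  omega

lemma kadE_gt (n m : ℕ) (hm : n < m) (t : Fin n → ℂ) : kadE n m t = 0 := by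
  unfold kadE
  rw [Finset.powersetCard_eq_empty.2 (by simpa using hm)]
  simp

open Polynomial in
lemma kadE_coeffX (n m : ℕ) (hm : m ≤ n + 1) (t : Fin n → ℂ) :
    (X * ∏ i, (X + C (t i))).coeff (n + 1 - m) = kadE n m t := by
  rcases Nat.lt_or_ge n m with h | h
  · have : n + 1 - m = 0 := by omega
    rw [this, kadE_gt n m h]; simp
  · have : n + 1 - m = (n - m) + 1 := by omega
    rw [this, coeff_X_mul, kadE_coeff _ _ h]

lemma kadE_mul (n m : ℕ) (Q : ℂ) (t : Fin n → ℂ) :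
    kadE n m (fun i => Q * t i) = Q ^ m * kadE n m t := by
  unfold kadE
  rw [Finset.mul_sum]
  refine Finset.sum_congr rfl fun S hS => ?_
  rw [Finset.prod_mul_distrib, Finset.prod_const, (Finset.mem_powersetCard.1 hS).2]

noncomputable def kadc (n : ℕ) (Q : ℂ) (t : Fin (n+1) → ℂ) (k : Fin (n+1)) : ℂ :=
  ∏ i : Fin n, ((t k - Q * t (Equiv.swap 0 k i.succ)) / (t k - t (Equiv.swap 0 k i.succ)))

open Polynomial in
lemma kad_sum0 (n m : ℕ) (hm : m ≤ n + 1) (Q : ℂ) (t : Fin (n+1) → ℂ) (ht : Function.Injective t) :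
    (1 - Q) * ∑ k, kadc n Q t k * kadE n m (fun i => t (Equiv.swap 0 k i.succ))
      = (Q ^ m - Q ^ (n+1)) * kadE (n+1) m t := by
  have h := congrArg (fun p => coeff p (n + 1 - m)) (kad_key n Q t ht)
  simp only [mul_assoc, coeff_C_mul, Finset.mul_sum, coeff_sub, finsetSum_coeff] at h
  rw [kadE_coeff _ _ hm t, kadE_coeff _ _ hm (fun i => Q * t i), kadE_mul] at h
  rw [sub_mul (Q ^ m), ← h, Finset.mul_sum]
  refine Finset.sum_congr rfl fun k _ => ?_
  rw [mul_left_comm X, coeff_C_mul, kadE_coeffX _ _ hm]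
  rfl

open Polynomial in
lemma kadE_split (n m : ℕ) (hm : m ≤ n) (t : Fin (n+1) → ℂ) (k : Fin (n+1)) :
    kadE (n+1) (m+1) t = kadE n (m+1) (fun i => t (Equiv.swap 0 k i.succ))
      + t k * kadE n m (fun i => t (Equiv.swap 0 k i.succ)) := by
  have hm' : m + 1 ≤ n + 1 := by omega
  rw [← kadE_coeff _ _ hm', ← kadE_coeffX _ _ hm', ← kadE_coeff _ _ hm,
    ← Equiv.prod_comp (Equiv.swap 0 k), Fin.prod_univ_succ, Equiv.swap_apply_left, add_mul, coeff_add,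
    coeff_C_mul]
  congr 3
  omega

lemma kad_sumc (n : ℕ) (Q : ℂ) (t : Fin (n+1) → ℂ) (ht : Function.Injective t) :
    (1 - Q) * ∑ k, kadc n Q t k = 1 - Q ^ (n+1) := by
  have := kad_sum0 n 0 (by omega) Q t ht
  simpa [kadE] using this

lemma kad_sum1 (n m : ℕ) (hm : m ≤ n) (Q : ℂ) (t : Fin (n+1) → ℂ) (ht : Function.Injective t) :
    (1 - Q) * ∑ k, kadc n Q t k * (t k * kadE n m (fun i => t (Equiv.swap 0 k i.succ)))
      = (1 - Q ^ (m+1)) * kadE (n+1) (m+1) t := by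
  have h1 := kad_sum0 n (m+1) (by omega) Q t ht
  have h2 := kad_sumc n Q t ht
  have h3 : ∑ k, kadc n Q t k * (t k * kadE n m (fun i => t (Equiv.swap 0 k i.succ)))
      = (∑ k, kadc n Q t k) * kadE (n+1) (m+1) t
        - ∑ k, kadc n Q t k * kadE n (m+1) (fun i => t (Equiv.swap 0 k i.succ)) := by
    rw [Finset.sum_mul, ← Finset.sum_sub_distrib]
    refine Finset.sum_congr rfl fun k _ => ?_
    rw [kadE_split n m hm t k]; ring
  rw [h3, mul_sub, h1, ← mul_assoc, h2]; ring

/-- Vandermonde-type product -/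
noncomputable def kadV (n : ℕ) (t : Fin n → ℂ) : ℂ := ∏ i, ∏ j ∈ Finset.Ioi i, (t i - t j)

lemma kadV_perm (n : ℕ) (t : Fin n → ℂ) (σ : Equiv.Perm (Fin n)) :
    kadV n (fun i => t (σ i)) = ((Equiv.Perm.sign σ : ℤ) : ℂ) * kadV n t := by
  have := Equiv.Perm.prod_Ioi_comp_eq_sign_mul_prod (R := ℂ) σ (f := fun i j => t i - t j)
    (fun i j => (neg_sub _ _).symm)
  exact this

lemma kadV_succ (n : ℕ) (t : Fin (n+1) → ℂ) :
    kadV (n+1) t = (∏ i : Fin n, (t 0 - t i.succ)) * kadV n (fun i => t i.succ) := by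
  unfold kadV
  rw [Fin.prod_univ_succ, Fin.prod_Ioi_zero]
  simp only [Fin.prod_Ioi_succ]

lemma kadV_swap (n : ℕ) (Q : ℂ) (t : Fin (n+1) → ℂ) (ht : Function.Injective t) (k : Fin (n+1)) :
    ((Equiv.Perm.sign (Equiv.swap 0 k) : ℤ) : ℂ) * (∏ i : Fin n, (t k - Q * t (Equiv.swap 0 k i.succ))) *
      kadV n (fun i => t (Equiv.swap 0 k i.succ)) = kadc n Q t k * kadV (n+1) t := by
  have h1 := kadV_perm (n+1) t (Equiv.swap 0 k)
  rw [kadV_succ] at h1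
  simp only [Equiv.swap_apply_left] at h1
  have hs : ((Equiv.Perm.sign (Equiv.swap 0 k) : ℤ) : ℂ) * ((Equiv.Perm.sign (Equiv.swap 0 k) : ℤ) : ℂ) = 1 := by
    rw [← Int.cast_mul, ← Units.val_mul, Int.units_mul_self]; simp
  have h2 : kadV (n+1) t = ((Equiv.Perm.sign (Equiv.swap 0 k) : ℤ) : ℂ) *
     ((∏ i : Fin n, (t k - t (Equiv.swap 0 k i.succ))) * kadV n (fun i => t (Equiv.swap 0 k i.succ))) := by
    rw [h1, ← mul_assoc, hs, one_mul]
  have hne : (∏ i : Fin n, (t k - t (Equiv.swap 0 k i.succ))) ≠ 0 := by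
    refine Finset.prod_ne_zero_iff.2 fun i _ h => ?_
    have h1 := ht (sub_eq_zero.1 h)
    have h2 : Equiv.swap 0 k 0 = Equiv.swap 0 k i.succ := by
      rw [Equiv.swap_apply_left]; exact h1
    exact (Fin.succ_ne_zero i).symm ((Equiv.swap 0 k).injective h2)
  rw [h2, kadc, Finset.prod_div_distrib]
  field_simp

noncomputable def kadL (n : ℕ) (Q : ℂ) (J : Finset (Fin n)) (t : Fin n → ℂ) : ℂ :=
  ∑ σ : Equiv.Perm (Fin n), ((Equiv.Perm.sign σ : ℤ) : ℂ) * (∏ j, if j ∈ J then t (σ j) else 1) *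
    ∏ i, ∏ j ∈ Finset.Ioi i, (t (σ i) - Q * t (σ j))

noncomputable def kadQ (n : ℕ) (Q : ℂ) (J : Finset (Fin n)) : ℂ :=
  ∏ i, ∏ j ∈ Finset.Ioi i, (if i ∉ J ∧ j ∈ J then Q else 1)

def kadJ (n : ℕ) (J : Finset (Fin (n+1))) : Finset (Fin n) := Finset.univ.filter (fun i => i.succ ∈ J)

lemma kadL_succ (n : ℕ) (Q : ℂ) (J : Finset (Fin (n+1))) (t : Fin (n+1) → ℂ) :
    kadL (n+1) Q J t = ∑ k, ((Equiv.Perm.sign (Equiv.swap 0 k) : ℤ) : ℂ) *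
      (if 0 ∈ J then t k else 1) * (∏ i : Fin n, (t k - Q * t (Equiv.swap 0 k i.succ))) *
      kadL n Q (kadJ n J) (fun i => t (Equiv.swap 0 k i.succ)) := by
  unfold kadL
  rw [← Equiv.sum_comp Equiv.Perm.decomposeFin.symm, Fintype.sum_prod_type]
  refine Finset.sum_congr rfl fun k _ => ?_
  rw [Finset.mul_sum]
  refine Finset.sum_congr rfl fun τ _ => ?_
  have hs : Equiv.Perm.sign (Equiv.Perm.decomposeFin.symm (k, τ))
      = Equiv.Perm.sign (Equiv.swap 0 k) * Equiv.Perm.sign τ := by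
    rw [Equiv.Perm.decomposeFin.symm_sign]
    by_cases hk : k = 0
    · simp [hk]
    · rw [Equiv.Perm.sign_swap (Ne.symm hk)]; simp [hk]
  rw [hs, Fin.prod_univ_succ, Fin.prod_univ_succ, Fin.prod_Ioi_zero]
  simp only [Fin.prod_Ioi_succ, Equiv.Perm.decomposeFin_symm_apply_zero,
    Equiv.Perm.decomposeFin_symm_apply_succ, kadJ, Finset.mem_filter, Finset.mem_univ, true_and]
  rw [Equiv.prod_comp τ (fun i => t k - Q * t (Equiv.swap 0 k i.succ))]
  push_cast
  ring

lemma kadJ_card (n : ℕ) (J : Finset (Fin (n+1))) :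
    J.card = (if 0 ∈ J then 1 else 0) + (kadJ n J).card := by
  unfold kadJ
  have := Fin.sum_univ_succ (fun i => if i ∈ J then 1 else 0)
  simp only [Finset.sum_boole, Finset.filter_univ_mem] at this
  simpa using this

lemma kadQ_succ (n : ℕ) (Q : ℂ) (J : Finset (Fin (n+1))) :
    kadQ (n+1) Q J = (if 0 ∈ J then 1 else Q ^ (kadJ n J).card) * kadQ n Q (kadJ n J) := by
  unfold kadQ
  rw [Fin.prod_univ_succ, Fin.prod_Ioi_zero]
  simp only [Fin.prod_Ioi_succ, kadJ, Finset.mem_filter, Finset.mem_univ, true_and]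
  congr 1
  by_cases h : 0 ∈ J
  · simp [h]
  · simp [h, Finset.prod_ite]

lemma kad_main (n : ℕ) (Q : ℂ) : ∀ (J : Finset (Fin n)) (t : Fin n → ℂ), Function.Injective t →
    kadL n Q J t * (1 - Q) ^ n = kadQ n Q J * (qPoch Q Q J.card * qPoch Q Q (n - J.card)) *
      kadE n J.card t * kadV n t := by
  induction n with
  | zero =>
    intro J t ht
    have : J = ∅ := Finset.eq_empty_of_isEmpty J
    subst this
    simp [kadL, kadQ, qPoch, kadE, kadV]
  | succ n ih =>
    intro J t ht
    have hc := kadJ_card n J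
    have hle : (kadJ n J).card ≤ n := by simpa using Finset.card_le_univ (kadJ n J)
    set m := (kadJ n J).card with hm
    have step : kadL (n+1) Q J t * (1 - Q) ^ (n+1) =
        kadQ n Q (kadJ n J) * (qPoch Q Q m * qPoch Q Q (n - m)) * kadV (n+1) t *
        ((1 - Q) * ∑ k, kadc n Q t k * ((if 0 ∈ J then t k else 1) *
          kadE n m (fun i => t (Equiv.swap 0 k i.succ)))) := by
      rw [kadL_succ, pow_succ, Finset.sum_mul, Finset.mul_sum, Finset.mul_sum]
      refine Finset.sum_congr rfl fun k _ => ?_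
      have hi := ih (kadJ n J) (fun i => t (Equiv.swap 0 k i.succ))
        (fun a b h => Fin.succ_injective _ ((Equiv.swap 0 k).injective (ht h)))
      have hv := kadV_swap n Q t ht k
      linear_combination ((Equiv.Perm.sign (Equiv.swap 0 k) : ℤ) : ℂ) *
        (if 0 ∈ J then t k else 1) * (∏ i : Fin n, (t k - Q * t (Equiv.swap 0 k i.succ))) * (1 - Q) * hi
        + kadQ n Q (kadJ n J) * (qPoch Q Q m * qPoch Q Q (n - m)) * (1 - Q) *
          (if 0 ∈ J then t k else 1) * kadE n m (fun i => t (Equiv.swap 0 k i.succ)) * hv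
    rw [step, kadQ_succ]
    have hq : ∀ a, qPoch Q Q (a+1) = qPoch Q Q a * (1 - Q ^ (a+1)) := by
      intro a; unfold qPoch; rw [Finset.prod_range_succ, pow_succ]
    by_cases h0 : 0 ∈ J
    · simp only [h0, if_true] at hc ⊢
      rw [kad_sum1 n m hle Q t ht, hc, add_comm 1 m, hq, Nat.add_sub_add_right]
      ring
    · simp only [h0, if_false, zero_add, one_mul] at hc ⊢
      rw [kad_sum0 n m (by omega) Q t ht, hc, Nat.sub_add_comm hle, hq, ← hm]
      have : Q ^ (n+1) = Q ^ m * Q ^ (n - m + 1) := by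
        rw [← pow_add]; congr 1; omega
      rw [this]; ring

lemma kad_pairs (n : ℕ) (f : Fin n → Fin n → ℂ) :
    ∏ p ∈ Finset.univ.filter (fun p : Fin n × Fin n => p.1 < p.2), f p.1 p.2
      = ∏ i, ∏ j ∈ Finset.Ioi i, f i j := by
  rw [Finset.prod_filter, Fintype.prod_prod_type]
  refine Finset.prod_congr rfl fun i _ => ?_
  rw [← Finset.prod_filter]
  refine Finset.prod_congr ?_ fun _ _ => rfl
  ext j; simp

lemma kadL_noninj (n : ℕ) (Q : ℂ) (J : Finset (Fin n)) (t : Fin n → ℂ) (a b : Fin n) (hab : a ≠ b)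
    (h : t a = t b) : kadL n Q J t = 0 := by
  have hsw : ∀ i, t (Equiv.swap a b i) = t i := by
    intro i
    by_cases h1 : i = a
    · rw [h1, Equiv.swap_apply_left, h]
    by_cases h2 : i = b
    · rw [h2, Equiv.swap_apply_right, h]
    rw [Equiv.swap_apply_of_ne_of_ne h1 h2]
  have : kadL n Q J t = - kadL n Q J t := by
    conv_lhs => unfold kadL
    rw [← Equiv.sum_comp (Equiv.mulLeft (Equiv.swap a b))]
    unfold kadL
    rw [← Finset.sum_neg_distrib]
    refine Finset.sum_congr rfl fun σ _ => ?_
    simp [hsw, Equiv.Perm.sign_swap hab]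
  exact self_eq_neg.1 this

/-- Kadell's lemma: the antisymmetrization of `∏_{j∈J} t_j ∏_{i<j} (t_i − Q t_j)`
equals `Q^{e(J)} (Q;Q)_{|J|}(Q;Q)_{n−|J|}/(1−Q)^n · e_{|J|}(t) · ∏_{i<j}(t_i − t_j)`,
stated as an identity of functions of `t₁,…,t_n` (hence of polynomials, since ℂ is
infinite). -/
theorem kadell_lemma (n : ℕ) (hn : 1 ≤ n) (Q : ℂ) (hQ : Q ≠ 1) (J : Finset (Fin n))
    (t : Fin n → ℂ) :
    ∑ σ : Equiv.Perm (Fin n),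
      ((Equiv.Perm.sign σ : ℤ) : ℂ) * (∏ j ∈ J, t (σ j)) *
        ∏ p ∈ Finset.univ.filter (fun p : Fin n × Fin n => p.1 < p.2),
          (t (σ p.1) - Q * t (σ p.2))
    = Q ^ ((Finset.univ.filter
            (fun p : Fin n × Fin n => p.1 < p.2 ∧ p.1 ∉ J ∧ p.2 ∈ J)).card) *
        (qPoch Q Q J.card * qPoch Q Q (n - J.card) / (1 - Q) ^ n) *
        (∑ S ∈ Finset.powersetCard J.card (Finset.univ : Finset (Fin n)), ∏ i ∈ S, t i) *
        ∏ p ∈ Finset.univ.filter (fun p : Fin n × Fin n => p.1 < p.2),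
          (t p.1 - t p.2) := by
  have hL : ∑ σ : Equiv.Perm (Fin n),
      ((Equiv.Perm.sign σ : ℤ) : ℂ) * (∏ j ∈ J, t (σ j)) *
        ∏ p ∈ Finset.univ.filter (fun p : Fin n × Fin n => p.1 < p.2),
          (t (σ p.1) - Q * t (σ p.2)) = kadL n Q J t := by
    unfold kadL
    refine Finset.sum_congr rfl fun σ _ => ?_
    rw [kad_pairs n (fun i j => t (σ i) - Q * t (σ j))]
    simp
  have hE : Q ^ ((Finset.univ.filter
      (fun p : Fin n × Fin n => p.1 < p.2 ∧ p.1 ∉ J ∧ p.2 ∈ J)).card) = kadQ n Q J := by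
    unfold kadQ
    rw [← kad_pairs n (fun i j => if i ∉ J ∧ j ∈ J then Q else 1), ← Finset.prod_filter,
      Finset.prod_const, Finset.filter_filter]
  have hV : ∏ p ∈ Finset.univ.filter (fun p : Fin n × Fin n => p.1 < p.2), (t p.1 - t p.2)
      = kadV n t := kad_pairs n (fun i j => t i - t j)
  have hEE : (∑ S ∈ Finset.powersetCard J.card (Finset.univ : Finset (Fin n)), ∏ i ∈ S, t i)
      = kadE n J.card t := rfl
  rw [hL, hE, hV, hEE]
  by_cases ht : Function.Injective t
  · have h1 := kad_main n Q J t ht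
    have h2 : (1 - Q) ^ n ≠ 0 := pow_ne_zero _ (sub_ne_zero.2 (Ne.symm hQ))
    field_simp
    rw [h1]
    ring
  · obtain ⟨a, b, h, hab⟩ := Function.not_injective_iff.1 ht
    rw [kadL_noninj n Q J t a b hab h]
    have : kadV n t = 0 := by
      unfold kadV
      rcases lt_or_gt_of_ne hab with hlt | hlt
      · exact Finset.prod_eq_zero (Finset.mem_univ a)
          (Finset.prod_eq_zero (Finset.mem_Ioi.2 hlt) (by rw [h, sub_self]))
      · exact Finset.prod_eq_zero (Finset.mem_univ b)
          (Finset.prod_eq_zero (Finset.mem_Ioi.2 hlt) (by rw [h, sub_self]))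
    rw [this, mul_zero]
end

section
/- Fix n ≥ 1, 0 ≤ r ≤ n, and nonzero complex numbers x₁, x₂, a with a^m ≠ 1 for all 1 ≤ m ≤ n and x₂ ≠ x₁ a^m for every integer m with |m| ≤ n. Let ν₁ < ⋯ < ν_{n−r} and ν_{n−r+1} < ⋯ < ν_n be integers with {ν₁,…,ν_n} = {1,…,n}, and let σ ∈ S_n satisfy {σ(ν₁),…,σ(ν_{n−r})} = {1,…,n−r} and {σ(ν_{n−r+1}),…,σ(ν_n)} = {n−r+1,…,n}. Then ∏_{1≤i<j≤n} (ξ_{σ(i)} − a^{−1} ξ_{σ(j)}) ≠ 0 if and only if σ(ν₁) = n−r > σ(ν₂) > ⋯ > σ(ν_{n−r}) = 1 and σ(ν_{n−r+1}) = n > σ(ν_{n−r+2}) > ⋯ > σ(ν_n) = n−r+1. (Lemma 7.2.) -/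
open Finset

/-- The characteristic point `ξ = ξ_r ∈ ℂⁿ`: `ξ_i = x₁ a^{i−1}` for `1 ≤ i ≤ n−r` and
`ξ_{n−r+i} = x₂ a^{i−1}` for `1 ≤ i ≤ r` (here indexed by `Fin n`, zero-based). -/
noncomputable def xiPt (n r : ℕ) (x₁ x₂ a : ℂ) (i : Fin n) : ℂ :=
  if (i : ℕ) < n - r then x₁ * a ^ (i : ℕ) else x₂ * a ^ ((i : ℕ) - (n - r))

lemma dec_aux (lo hi : ℕ) (f : ℕ → ℕ) (h1 : ∀ u, lo ≤ u → u < hi → lo ≤ f u ∧ f u < hi)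
    (h2 : ∀ u, lo ≤ u → u + 1 < hi → f (u+1) < f u) (u : ℕ) (hu : lo ≤ u) (huu : u < hi) :
    f u + u + 1 = lo + hi := by
  have hup : ∀ k, lo + k < hi → f (lo + k) + k + 1 ≤ hi := by
    intro k
    induction k with
    | zero => intro h; have := h1 lo le_rfl (by omega); simp; omega
    | succ k ih =>
      intro h
      have := ih (by omega)
      have h3 := h2 (lo + k) (by omega) (by omega)
      rw [show lo + (k+1) = lo + k + 1 by ring]; omega
  have hdn : ∀ k u, lo ≤ u → u + k + 1 = hi → lo + k ≤ f u := by
    intro k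
    induction k with
    | zero => intro u h hh; have := h1 u h (by omega); omega
    | succ k ih =>
      intro u h hh
      have := ih (u+1) (by omega) (by omega)
      have h3 := h2 u (by omega) (by omega)
      omega
  have e1 := hup (u - lo) (by omega)
  rw [show lo + (u - lo) = u by omega] at e1
  have e2 := hdn (hi - u - 1) u hu (by omega)
  omega

lemma pow_inj_aux (n : ℕ) (a : ℂ) (ha : a ≠ 0)
    (ha1 : ∀ m : ℕ, 1 ≤ m → m ≤ n → a ^ m ≠ 1) (s t : ℕ) (hs : s ≤ n) (ht : t ≤ n)
    (h : a ^ s = a ^ t) : s = t := by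
  rcases lt_trichotomy s t with hl | hl | hl
  · exfalso
    obtain ⟨k, rfl⟩ := Nat.exists_eq_add_of_lt hl
    refine ha1 (k+1) (by omega) (by omega) ?_
    have h0 : a ^ s ≠ 0 := pow_ne_zero _ ha
    apply mul_left_cancel₀ h0
    rw [mul_one, ← pow_add, ← add_assoc, ← h]
  · exact hl
  · exfalso
    obtain ⟨k, rfl⟩ := Nat.exists_eq_add_of_lt hl
    refine ha1 (k+1) (by omega) (by omega) ?_
    have h0 : a ^ t ≠ 0 := pow_ne_zero _ ha
    apply mul_left_cancel₀ h0
    rw [mul_one, ← pow_add, ← add_assoc, h]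

lemma gen_aux (n : ℕ) (x₁ x₂ a : ℂ) (ha : a ≠ 0)
    (hgen : ∀ m : ℤ, |m| ≤ (n : ℤ) → x₂ ≠ x₁ * a ^ m) (s t : ℕ) (hs : s ≤ n) (ht : t ≤ n) :
    x₂ * a ^ t ≠ x₁ * a ^ s := by
  intro h
  refine hgen ((s : ℤ) - t) (by rw [abs_le]; constructor <;> omega) ?_
  have h0 : a ^ t ≠ 0 := pow_ne_zero _ ha
  rw [zpow_sub₀ ha, zpow_natCast, zpow_natCast]
  field_simp
  exact h

lemma factor_aux (n r : ℕ) (hr : r ≤ n) (x₁ x₂ a : ℂ)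
    (hx₁ : x₁ ≠ 0) (hx₂ : x₂ ≠ 0) (ha : a ≠ 0)
    (ha1 : ∀ m : ℕ, 1 ≤ m → m ≤ n → a ^ m ≠ 1)
    (hgen : ∀ m : ℤ, |m| ≤ (n : ℤ) → x₂ ≠ x₁ * a ^ m) (s t : Fin n) :
    xiPt n r x₁ x₂ a s - a⁻¹ * xiPt n r x₁ x₂ a t = 0 ↔
      (((s : ℕ) < n - r ↔ (t : ℕ) < n - r) ∧ (t : ℕ) = s + 1) := by
  have key : xiPt n r x₁ x₂ a s - a⁻¹ * xiPt n r x₁ x₂ a t = 0 ↔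
      xiPt n r x₁ x₂ a s * a = xiPt n r x₁ x₂ a t := by
    rw [sub_eq_zero, eq_inv_mul_iff_mul_eq₀ ha, mul_comm]
  rw [key]
  have hs := s.2
  have ht := t.2
  unfold xiPt
  split_ifs with h1 h2 h2 <;> rw [mul_assoc, ← pow_succ]
  · constructor
    · intro h
      have := pow_inj_aux n a ha ha1 _ _ (by omega) (by omega) (mul_left_cancel₀ hx₁ h)
      exact ⟨by tauto, this.symm⟩
    · rintro ⟨_, h⟩; rw [h]
  · constructor
    · intro h
      exact absurd h.symm (gen_aux n x₁ x₂ a ha hgen _ _ (by omega) (by omega))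
    · rintro ⟨h, _⟩; tauto
  · constructor
    · intro h
      exact absurd h (gen_aux n x₁ x₂ a ha hgen _ _ (by omega) (by omega))
    · rintro ⟨h, _⟩; tauto
  · constructor
    · intro h
      have := pow_inj_aux n a ha ha1 _ _ (by omega) (by omega) (mul_left_cancel₀ hx₂ h)
      exact ⟨by tauto, by omega⟩
    · rintro ⟨_, h⟩
      rw [show (t : ℕ) - (n - r) = s - (n - r) + 1 by omega]

/-- Lemma 7.2: for a shuffle-type permutation the factor
`∏_{i<j} (ξ_{σ(i)} − a⁻¹ ξ_{σ(j)})` is nonzero iff `σ∘ν` is decreasing on each block,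
taking the extreme values described. -/
theorem lemma7_2 (n r : ℕ) (hn : 1 ≤ n) (hr : r ≤ n) (x₁ x₂ a : ℂ)
    (hx₁ : x₁ ≠ 0) (hx₂ : x₂ ≠ 0) (ha : a ≠ 0)
    (ha1 : ∀ m : ℕ, 1 ≤ m → m ≤ n → a ^ m ≠ 1)
    (hgen : ∀ m : ℤ, |m| ≤ (n : ℤ) → x₂ ≠ x₁ * a ^ m)
    (ν : Fin n → Fin n) (hν : Function.Bijective ν)
    (hν₁ : ∀ i j : Fin n, i < j → (j : ℕ) < n - r → ν i < ν j)
    (hν₂ : ∀ i j : Fin n, n - r ≤ (i : ℕ) → i < j → ν i < ν j)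
    (σ : Equiv.Perm (Fin n))
    (hσ : ∀ i : Fin n, (i : ℕ) < n - r ↔ ((σ (ν i)) : ℕ) < n - r) :
    (∏ p ∈ Finset.univ.filter (fun p : Fin n × Fin n => p.1 < p.2),
        (xiPt n r x₁ x₂ a (σ p.1) - a⁻¹ * xiPt n r x₁ x₂ a (σ p.2))) ≠ 0
    ↔ (∀ i : Fin n,
        ((i : ℕ) < n - r → ((σ (ν i)) : ℕ) = n - r - 1 - (i : ℕ)) ∧
        (n - r ≤ (i : ℕ) → ((σ (ν i)) : ℕ) = 2 * n - r - 1 - (i : ℕ))) := by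

  rw [Finset.prod_ne_zero_iff]
  constructor
  · intro H
    let e : Fin n ≃ Fin n := (Equiv.ofBijective ν hν).trans σ
    have he : ∀ i, e i = σ (ν i) := fun i => rfl
    let f : ℕ → ℕ := fun u => if h : u < n then (e.symm ⟨u, h⟩ : ℕ) else 0
    have hf : ∀ u (h : u < n), f u = (e.symm ⟨u, h⟩ : ℕ) := fun u h => by simp [f, h]
    have hblk : ∀ u (h : u < n), (f u < n - r ↔ u < n - r) := by
      intro u h
      rw [hf u h, hσ, ← he, Equiv.apply_symm_apply]
    have hlt : ∀ u, u < n → f u < n := fun u h => by rw [hf u h]; exact Fin.isLt _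
    have hdec : ∀ u, u + 1 < n → (u < n - r ↔ u + 1 < n - r) → f (u+1) < f u := by
      intro u h hb
      have b1 := hblk u (by omega)
      have b2 := hblk (u+1) h
      rw [hf u (by omega)] at b1 ⊢
      rw [hf (u+1) h] at b2 ⊢
      set i := e.symm ⟨u, by omega⟩ with hi
      set j := e.symm ⟨u+1, h⟩ with hj
      have ei : σ (ν i) = ⟨u, by omega⟩ := by rw [← he, hi, Equiv.apply_symm_apply]
      have ej : σ (ν j) = ⟨u+1, h⟩ := by rw [← he, hj, Equiv.apply_symm_apply]
      by_contra hc
      have hij : i < j := by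
        rcases lt_or_eq_of_le (not_lt.mp hc) with hh | hh
        · exact hh
        · exfalso
          have : i = j := Fin.ext hh
          rw [this, ej] at ei
          simp at ei
      have hνij : ν i < ν j := by
        by_cases hu : u < n - r
        · exact hν₁ i j hij (by omega)
        · exact hν₂ i j (by omega) hij
      refine H (ν i, ν j) (by simpa using hνij) ?_
      rw [factor_aux n r hr x₁ x₂ a hx₁ hx₂ ha ha1 hgen]
      simp only [ei, ej]
      exact ⟨hb, trivial⟩
    intro i
    have hu := (σ (ν i)).2
    have hfi : f (σ (ν i)) = i := by
      rw [hf _ hu]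
      congr 1
      rw [Equiv.symm_apply_eq, he]
    have hb := hσ i
    constructor
    · intro h
      have := dec_aux 0 (n - r) f
        (fun u _ hu => ⟨Nat.zero_le _, (hblk u (by omega)).2 hu⟩)
        (fun u _ hu => hdec u (by omega) (by omega)) (σ (ν i)) (by omega) (by omega)
      omega
    · intro h
      have := dec_aux (n - r) n f
        (fun u hu huu => ⟨by have := hblk u huu; omega, hlt u huu⟩)
        (fun u _ hu => hdec u (by omega) (by omega)) (σ (ν i)) (by omega) (by omega)
      omega
  · rintro H ⟨p, q⟩ hpq
    simp only [Finset.mem_filter, Finset.mem_univ, true_and] at hpq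
    obtain ⟨i, rfl⟩ := hν.2 p
    obtain ⟨j, rfl⟩ := hν.2 q
    rw [Ne, factor_aux n r hr x₁ x₂ a hx₁ hx₂ ha ha1 hgen]
    rintro ⟨hb, hq⟩
    simp only at hb hq
    have h1 := hσ i
    have h2 := hσ j
    have e1 := H i
    have e2 := H j
    have hi := i.2
    have hj := j.2
    have hji : j < i := by
      rw [Fin.lt_def]
      by_cases h : (i : ℕ) < n - r
      · have := e1.1 h
        have := e2.1 (by omega)
        omega
      · have := e1.2 (by omega)
        have := e2.2 (by omega)
        omega
    have : ν j < ν i := by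
      by_cases h : (i : ℕ) < n - r
      · exact hν₁ j i hji h
      · exact hν₂ j i (by omega) hji
    exact absurd hpq (not_lt.mpr this.le)
end

section
/- Fix n ≥ 1, 0 ≤ r < s ≤ n, and nonzero complex numbers x₁, x₂, a, b₂ with a^m ≠ 1 for all 1 ≤ m ≤ n and x₂ ≠ x₁ a^m for every integer m with |m| ≤ n. Then the alternating sum vanishes: 𝒜(φ_s·D_a)(ξ) := Σ_{σ∈S_n} sgn(σ) · φ_s(ξ_{σ(1)},…,ξ_{σ(n)}) · ∏_{1≤i<j≤n}(ξ_{σ(i)} − a^{−1} ξ_{σ(j)}) = 0. (Lemma 7.4; equivalently, the coefficient matrix C_A⁺ of Proposition 3.1 is lower triangular.) -/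
open Finset

/-- `φ_s(t₁,…,t_n) = ∏_{k=1}^{n−s}(1 − b₂ t_k/x₂) · ∏_{k=n−s+1}^{n}(1 − t_k/x₁)`. -/
noncomputable def phiFun (n s : ℕ) (x₁ x₂ b₂ : ℂ) (t : Fin n → ℂ) : ℂ :=
  (∏ i ∈ Finset.univ.filter (fun i : Fin n => (i : ℕ) < n - s), (1 - b₂ * t i / x₂)) *
    ∏ i ∈ Finset.univ.filter (fun i : Fin n => n - s ≤ (i : ℕ)), (1 - t i / x₁)

/-- Lemma 7.4: for `r < s` the alternating sum `𝒜(φ_s·D_a)(ξ)` vanishes; equivalently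
the coefficient matrix `C_A⁺` of Proposition 3.1 is lower triangular. -/
theorem lemma7_4 (n r s : ℕ) (hn : 1 ≤ n) (hrs : r < s) (hs : s ≤ n)
    (x₁ x₂ a b₂ : ℂ) (hx₁ : x₁ ≠ 0) (hx₂ : x₂ ≠ 0) (ha : a ≠ 0) (hb₂ : b₂ ≠ 0)
    (ha1 : ∀ m : ℕ, 1 ≤ m → m ≤ n → a ^ m ≠ 1)
    (hgen : ∀ m : ℤ, |m| ≤ (n : ℤ) → x₂ ≠ x₁ * a ^ m) :
    ∑ σ : Equiv.Perm (Fin n),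
      ((Equiv.Perm.sign σ : ℤ) : ℂ) *
        phiFun n s x₁ x₂ b₂ (fun i => xiPt n r x₁ x₂ a (σ i)) *
        ∏ p ∈ Finset.univ.filter (fun p : Fin n × Fin n => p.1 < p.2),
          (xiPt n r x₁ x₂ a (σ p.1) - a⁻¹ * xiPt n r x₁ x₂ a (σ p.2)) = 0 := by
  refine Finset.sum_eq_zero fun σ _ => ?_
  by_contra hne
  have hphi := right_ne_zero_of_mul (left_ne_zero_of_mul hne)
  have hD := right_ne_zero_of_mul hne
  rw [Finset.prod_ne_zero_iff] at hD
  have hphi2 := right_ne_zero_of_mul hphi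
  rw [Finset.prod_ne_zero_iff] at hphi2
  -- consecutive points on the first string occur in reversed order
  have hstep : ∀ k (hk : k + 1 < n - r),
      (σ.symm ⟨k + 1, by omega⟩ : Fin n) < σ.symm ⟨k, by omega⟩ := by
    intro k hk
    by_contra hlt
    have hneq : (σ.symm ⟨k, by omega⟩ : Fin n) ≠ σ.symm ⟨k + 1, by omega⟩ := by
      intro h
      have := σ.symm.injective h
      simp at this
    have hlt2 := lt_of_le_of_ne (not_lt.mp hlt) hneq
    refine hD (σ.symm ⟨k, by omega⟩, σ.symm ⟨k + 1, by omega⟩) (by simpa using hlt2) ?_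
    have hk' : k < n - r := by omega
    simp only [Equiv.apply_symm_apply, xiPt, hk, hk', if_true]
    field_simp
    ring
  have hall : ∀ k (hk : k < n - r),
      ((σ.symm ⟨k, by omega⟩ : Fin n) : ℕ) + k ≤ (σ.symm ⟨0, by omega⟩ : Fin n) := by
    intro k
    induction k with
    | zero => intro hk; simp
    | succ k ih =>
      intro hk
      have h1 := ih (by omega)
      have h2 : ((σ.symm ⟨k + 1, by omega⟩ : Fin n) : ℕ) < (σ.symm ⟨k, by omega⟩ : Fin n) :=
        hstep k hk
      omega
  have hlast := hall (n - r - 1) (by omega)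
  refine hphi2 (σ.symm ⟨0, by omega⟩) (by simp only [mem_filter, mem_univ, true_and]; omega) ?_
  have h0 : 0 < n - r := by omega
  simp only [Equiv.apply_symm_apply, xiPt, h0, if_true, pow_zero, mul_one]
  rw [div_self hx₁, sub_self]
end

section
/- Fix n ≥ 1, 0 ≤ s ≤ r ≤ n, and nonzero complex numbers x₁, x₂, a, b₂ with a^m ≠ 1 for 1 ≤ m ≤ n, x₂ ≠ x₁ a^m for |m| ≤ n, b₂ a^m ≠ 1 for 0 ≤ m ≤ n−1, and b₂ x₁ a^m ≠ x₂ for 0 ≤ m ≤ n−1. Let w = w_{rs} ∈ S_n be defined by w(i) = i for 1 ≤ i ≤ n−r, w(i) = i+s for n−r+1 ≤ i ≤ n−s, and w(i) = 2n−r+1−i for n−s+1 ≤ i ≤ n, and let G_s(t₁,…,t_n) := ∏_{1≤i<j≤n−s}(t_i − t_j) · ∏_{1≤i≤n−s<j≤n}(t_i − a^{−1}t_j) · ∏_{n−s+1≤i<j≤n}(t_i − a^{−1}t_j). Then 𝒜(φ_s·D_a)(ξ) = [(a^{−1};a^{−1})_{n−s} / (1−a^{−1})^{n−s}] · sgn(w)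 · φ_s(ξ_{w(1)},…,ξ_{w(n)}) · G_s(ξ_{w(1)},…,ξ_{w(n)}). (Lemma 7.5.) -/
open Finset

/-- `G_s(t₁,…,t_n) = ∏_{1≤i<j≤n−s}(t_i − t_j) · ∏_{1≤i≤n−s<j≤n}(t_i − a⁻¹t_j)
· ∏_{n−s+1≤i<j≤n}(t_i − a⁻¹t_j)`: the factor of the pair `(i,j)` is `t_i − t_j`
when `j ≤ n−s` and `t_i − a⁻¹ t_j` otherwise. -/
noncomputable def Gfun (n s : ℕ) (a : ℂ) (t : Fin n → ℂ) : ℂ :=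
  ∏ p ∈ Finset.univ.filter (fun p : Fin n × Fin n => p.1 < p.2),
    (t p.1 - (if (p.2 : ℕ) < n - s then (1 : ℂ) else a⁻¹) * t p.2)


lemma aux_lagrange {m : ℕ} (q : ℂ) (hq : q ≠ 1) (t : Fin m → ℂ) (ht : Function.Injective t)
    (h0 : ∀ i, t i ≠ 0) :
    ∑ k, ∏ j, (if j = k then (1:ℂ) else (t k - q * t j) / (t k - t j)) = (1 - q ^ m) / (1 - q) := by
  have hq' : 1 - q ≠ 0 := sub_ne_zero.mpr (Ne.symm hq)
  let v : Option (Fin m) → ℂ := fun o => o.elim 0 t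
  let P : Polynomial ℂ := ∏ j : Fin m, (Polynomial.X - Polynomial.C (q * t j))
  have hmon : P.Monic := Polynomial.monic_prod_of_monic _ _ (fun j _ => Polynomial.monic_X_sub_C _)
  have hdeg : P.natDegree = m := by
    simp only [P]
    rw [Polynomial.natDegree_prod_of_monic _ _ (fun j _ => Polynomial.monic_X_sub_C _)]
    simp only [Polynomial.natDegree_X_sub_C]
    simp
  have hv : Set.InjOn v (Finset.univ : Finset (Option (Fin m))) := by
    rintro (_ | i) _ (_ | j) _ h
    · rfl
    · exact absurd h.symm (h0 j)
    · exact absurd h (h0 i)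
    · exact congrArg some (ht h)
  have key := Lagrange.coeff_eq_sum hv (P := P) (by
    rw [Polynomial.degree_eq_natDegree hmon.ne_zero, hdeg]
    simp only [Finset.card_univ, Fintype.card_option, Fintype.card_fin]
    exact_mod_cast Nat.lt_succ_self m)
  have hc : P.coeff (#(Finset.univ : Finset (Option (Fin m))) - 1) = 1 := by
    have := hmon.coeff_natDegree
    rw [hdeg] at this
    simpa using this
  rw [hc, Fintype.sum_option] at key
  have e0 : Polynomial.eval (v none) P / ∏ j ∈ Finset.univ.erase none, (v none - v j) = q ^ m := by
    have : ∏ j ∈ Finset.univ.erase none, (v none - v j) = ∏ j : Fin m, (- t j) := by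
      rw [← Finset.filter_ne', Finset.prod_filter, Fintype.prod_option]
      simp [v]
    rw [this]
    simp only [P, Polynomial.eval_prod, v, Option.elim, Polynomial.eval_sub, Polynomial.eval_X,
      Polynomial.eval_C]
    rw [← Finset.prod_div_distrib]
    rw [Finset.prod_congr rfl (g := fun _ => q)]
    · simp
    · intro j _
      have := h0 j
      field_simp
      simp
  have e1 : ∀ k, Polynomial.eval (v (some k)) P /
      ∏ j ∈ Finset.univ.erase (some k), (v (some k) - v j) =
      (1 - q) * ∏ j, (if j = k then (1:ℂ) else (t k - q * t j) / (t k - t j)) := by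
    intro k
    have : ∏ j ∈ Finset.univ.erase (some k), (v (some k) - v j)
        = t k * ∏ j : Fin m, (if j = k then 1 else (t k - t j)) := by
      rw [← Finset.filter_ne', Finset.prod_filter, Fintype.prod_option]
      simp [v, ite_not]
    rw [this]
    have h2 : Polynomial.eval (v (some k)) P = (t k * (1 - q)) *
        ∏ j : Fin m, (if j = k then 1 else (t k - q * t j)) := by
      simp only [P, Polynomial.eval_prod, v, Option.elim, Polynomial.eval_sub, Polynomial.eval_X,
        Polynomial.eval_C]
      rw [← Finset.mul_prod_erase _ _ (Finset.mem_univ k),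
        ← Finset.mul_prod_erase _ (fun j => if j = k then (1:ℂ) else (t k - q * t j)) (Finset.mem_univ k)]
      rw [Finset.prod_congr rfl (g := fun j => if j = k then (1:ℂ) else (t k - q * t j))
        (s₁ := Finset.univ.erase k)]
      · simp; left; ring
      · intro j hj
        simp [Finset.ne_of_mem_erase hj]
    rw [h2, mul_assoc, mul_div_mul_left _ _ (h0 k), mul_div_assoc, ← Finset.prod_div_distrib]
    congr 1
    apply Finset.prod_congr rfl
    intro j _
    split_ifs <;> simp
  rw [e0, Finset.sum_congr rfl (fun k _ => e1 k), ← Finset.mul_sum] at key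
  rw [eq_div_iff hq']
  linear_combination -key

noncomputable def PF {n : ℕ} (q : ℂ) (t : Fin n → ℂ) : ℂ :=
  ∏ i, ∏ j, if i < j then (t i - q * t j) / (t i - t j) else 1

lemma PF_succ {m : ℕ} (q : ℂ) (t : Fin (m+1) → ℂ) :
    PF q t = (∏ j : Fin m, (t 0 - q * t j.succ) / (t 0 - t j.succ)) * PF q (fun i => t i.succ) := by
  unfold PF
  rw [Fin.prod_univ_succ, Fin.prod_univ_succ]
  simp [Fin.prod_univ_succ]

lemma sum_PF (q : ℂ) (hq : q ≠ 1) : ∀ (m : ℕ) (t : Fin m → ℂ), Function.Injective t →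
    (∀ i, t i ≠ 0) →
    ∑ σ : Equiv.Perm (Fin m), PF q (fun i => t (σ i)) = ∏ k ∈ Finset.range m, ((1 - q^(k+1))/(1-q)) := by
  intro m
  induction m with
  | zero => intro t _ _; simp [PF]
  | succ m ih =>
    intro t ht h0
    rw [← Equiv.sum_comp Equiv.Perm.decomposeFin.symm, Fintype.sum_prod_type]
    simp only [PF_succ, Equiv.Perm.decomposeFin_symm_apply_zero,
      Equiv.Perm.decomposeFin_symm_apply_succ]
    have step : ∀ p : Fin (m+1), ∑ e : Equiv.Perm (Fin m),
        (∏ j : Fin m, (t p - q * t (Equiv.swap 0 p (e j).succ)) / (t p - t (Equiv.swap 0 p (e j).succ)))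
          * PF q (fun i => t (Equiv.swap 0 p (e i).succ))
        = (∏ j, (if j = p then (1:ℂ) else (t p - q * t j) / (t p - t j))) *
          ∏ k ∈ Finset.range m, ((1 - q^(k+1))/(1-q)) := by
      intro p
      rw [← ih (fun i => t (Equiv.swap 0 p i.succ))
        (fun i j h => Fin.succ_injective _ ((Equiv.swap 0 p).injective (ht h))) (fun i => h0 _),
        Finset.mul_sum]
      refine Finset.sum_congr rfl fun e _ => ?_
      congr 1
      rw [Equiv.prod_comp e (fun j => (t p - q * t (Equiv.swap 0 p j.succ)) / (t p - t (Equiv.swap 0 p j.succ)))]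
      rw [← Equiv.prod_comp (Equiv.swap 0 p), Fin.prod_univ_succ]
      simp only [Equiv.swap_apply_left, if_true, one_mul]
      refine Finset.prod_congr rfl fun j _ => ?_
      rw [if_neg]
      intro h
      have : Equiv.swap 0 p j.succ = Equiv.swap 0 p 0 := by simpa using h
      exact Fin.succ_ne_zero _ ((Equiv.swap 0 p).injective this)
    rw [Finset.sum_congr rfl (fun p _ => step p), ← Finset.sum_mul, aux_lagrange q hq t ht h0,
      Finset.prod_range_succ, mul_comm]

noncomputable def VF {n : ℕ} (t : Fin n → ℂ) : ℂ :=
  ∏ i, ∏ j, if i < j then (t i - t j) else 1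

lemma VF_eq_det {n : ℕ} (t : Fin n → ℂ) : VF t = (Matrix.vandermonde (fun i => - t i)).det := by
  rw [Matrix.det_vandermonde]
  unfold VF
  refine Finset.prod_congr rfl fun i _ => ?_
  rw [← Finset.filter_lt_eq_Ioi, Finset.prod_filter]
  refine Finset.prod_congr rfl fun j _ => ?_
  split_ifs <;> ring

lemma VF_perm {n : ℕ} (t : Fin n → ℂ) (σ : Equiv.Perm (Fin n)) :
    VF (fun i => t (σ i)) = ((Equiv.Perm.sign σ : ℤ) : ℂ) * VF t := by
  rw [VF_eq_det, VF_eq_det, ← Matrix.det_permute]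
  rfl

lemma prod_pairs {n : ℕ} (f : Fin n → Fin n → ℂ) :
    ∏ p ∈ Finset.univ.filter (fun p : Fin n × Fin n => p.1 < p.2), f p.1 p.2
      = ∏ i, ∏ j, if i < j then f i j else 1 := by
  rw [Finset.prod_filter, Fintype.prod_prod_type]

lemma D_eq {n : ℕ} (q : ℂ) (t : Fin n → ℂ) (ht : Function.Injective t) :
    ∏ p ∈ Finset.univ.filter (fun p : Fin n × Fin n => p.1 < p.2), (t p.1 - q * t p.2)
      = VF t * PF q t := by
  rw [prod_pairs (fun i j => t i - q * t j)]
  unfold VF PF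
  simp only [← Finset.prod_mul_distrib]
  refine Finset.prod_congr rfl fun i _ => Finset.prod_congr rfl fun j _ => ?_
  split_ifs with h
  · have : t i - t j ≠ 0 := sub_ne_zero.mpr (fun e => h.ne (ht e))
    field_simp
  · simp

/-- the part of the product with second index beyond `m`. -/
noncomputable def TF {n : ℕ} (m : ℕ) (q : ℂ) (t : Fin n → ℂ) : ℂ :=
  ∏ i : Fin n, ∏ j : Fin n, if i < j ∧ m ≤ (j:ℕ) then (t i - q * t j) / (t i - t j) else 1

lemma G_eq {n : ℕ} (s : ℕ) (a : ℂ) (t : Fin n → ℂ) (ht : Function.Injective t) :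
    Gfun n s a t = VF t * TF (n - s) a⁻¹ t := by
  unfold Gfun
  rw [prod_pairs (fun i j => t i - (if (j : ℕ) < n - s then (1 : ℂ) else a⁻¹) * t j)]
  unfold VF TF
  simp only [← Finset.prod_mul_distrib]
  refine Finset.prod_congr rfl fun i _ => Finset.prod_congr rfl fun j _ => ?_
  by_cases h : i < j
  · have : t i - t j ≠ 0 := sub_ne_zero.mpr (fun e => h.ne (ht e))
    by_cases h2 : (j:ℕ) < n - s
    · simp [h, h2, not_le.mpr h2]
    · simp only [h, h2, not_lt.mp h2, if_true, if_false, and_self]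
      field_simp
  · simp [h]

lemma PF_split {m s : ℕ} (q : ℂ) (t : Fin (m+s) → ℂ) :
    PF q t = PF q (fun i : Fin m => t (Fin.castAdd s i)) * TF m q t := by
  have h1 : PF q (fun i : Fin m => t (Fin.castAdd s i)) =
      ∏ i : Fin (m+s), ∏ j : Fin (m+s), if i < j ∧ (j:ℕ) < m then (t i - q * t j) / (t i - t j) else 1 := by
    rw [Fin.prod_univ_add]
    have : ∏ i : Fin s, ∏ j : Fin (m+s), (if Fin.natAdd m i < j ∧ (j:ℕ) < m then
        (t (Fin.natAdd m i) - q * t j) / (t (Fin.natAdd m i) - t j) else 1) = 1 := by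
      refine Finset.prod_eq_one fun i _ => Finset.prod_eq_one fun j _ => ?_
      rw [if_neg]
      rintro ⟨h, h'⟩
      rw [Fin.lt_def] at h
      simp at h
      omega
    rw [this, mul_one]
    unfold PF
    refine Finset.prod_congr rfl fun i _ => ?_
    rw [Fin.prod_univ_add]
    have hlt : ∀ x : Fin m, (Fin.castAdd s i < Fin.castAdd s x) ↔ i < x := fun x => Iff.rfl
    simp [hlt]
  rw [h1]
  unfold PF TF
  simp only [← Finset.prod_mul_distrib]
  refine Finset.prod_congr rfl fun i _ => Finset.prod_congr rfl fun j _ => ?_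
  by_cases h : i < j <;> by_cases h2 : (j:ℕ) < m <;> simp [h, h2]

lemma TF_perm {n : ℕ} (m : ℕ) (q : ℂ) (t : Fin n → ℂ) (τ : Equiv.Perm (Fin n))
    (hτ : ∀ i : Fin n, m ≤ (i:ℕ) → τ i = i) : TF m q (fun i => t (τ i)) = TF m q t := by
  unfold TF
  rw [Finset.prod_comm]
  conv_rhs => rw [Finset.prod_comm]
  refine Finset.prod_congr rfl fun j _ => ?_
  by_cases hj : m ≤ (j:ℕ)
  · rw [← Equiv.prod_comp τ (fun i => if i < j ∧ m ≤ (j:ℕ) then (t i - q * t j) / (t i - t j) else 1)]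
    refine Finset.prod_congr rfl fun i _ => ?_
    simp only [hτ j hj]
    have : τ i < j ↔ i < j := by
      by_cases hi : m ≤ (i:ℕ)
      · rw [hτ i hi]
      · have h2 : ¬ m ≤ (τ i : ℕ) := by
          intro h
          have := τ.injective (hτ _ h)
          rw [this] at h
          exact hi h
        simp only [Fin.lt_def]
        omega
    simp [this]
  · simp [hj]

lemma phi_perm {n : ℕ} (s : ℕ) (x₁ x₂ b₂ : ℂ) (t : Fin n → ℂ) (τ : Equiv.Perm (Fin n))
    (hτ : ∀ i : Fin n, n - s ≤ (i:ℕ) → τ i = i) :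
    phiFun n s x₁ x₂ b₂ (fun i => t (τ i)) = phiFun n s x₁ x₂ b₂ t := by
  have key : ∀ i : Fin n, n - s ≤ (τ i : ℕ) ↔ n - s ≤ (i : ℕ) := by
    intro i
    constructor
    · intro h
      have := τ.injective (hτ _ h)
      rwa [this] at h
    · intro h
      rwa [hτ i h]
  unfold phiFun
  congr 1
  · refine Finset.prod_equiv τ ?_ ?_
    · intro i
      have := key i
      simp
      omega
    · intro i _; rfl
  · refine Finset.prod_equiv τ ?_ ?_
    · intro i
      have := key i
      simp
      omega
    · intro i _; rfl

/-- extend a permutation of `Fin m` by the identity. -/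
def liftPerm {m : ℕ} (s : ℕ) (e : Equiv.Perm (Fin m)) : Equiv.Perm (Fin (m+s)) :=
  finSumFinEquiv.permCongr (Equiv.Perm.sumCongr e 1)

lemma liftPerm_castAdd {m s : ℕ} (e : Equiv.Perm (Fin m)) (i : Fin m) :
    liftPerm s e (Fin.castAdd s i) = Fin.castAdd s (e i) := by
  simp [liftPerm, Equiv.permCongr_apply]

lemma liftPerm_fix {m s : ℕ} (e : Equiv.Perm (Fin m)) (i : Fin (m+s)) (hi : m ≤ (i:ℕ)) :
    liftPerm s e i = i := by
  obtain ⟨j, rfl⟩ : ∃ j : Fin s, i = Fin.natAdd m j :=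
    ⟨⟨i - m, by omega⟩, by ext; simp; omega⟩
  simp [liftPerm, Equiv.permCongr_apply]

lemma liftPerm_inj {m s : ℕ} : Function.Injective (liftPerm (m := m) s) := by
  intro e e' h
  ext i
  have := congrArg (fun f => (f (Fin.castAdd s i) : ℕ)) h
  simpa [liftPerm_castAdd] using this

lemma liftPerm_surj {m s : ℕ} (τ : Equiv.Perm (Fin (m+s)))
    (hτ : ∀ i : Fin (m+s), m ≤ (i:ℕ) → τ i = i) : ∃ e, liftPerm s e = τ := by
  have key : ∀ i : Fin (m+s), (i:ℕ) < m → (τ i : ℕ) < m := by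
    intro i hi
    by_contra h
    have := τ.injective (hτ _ (not_lt.mp h))
    rw [this] at h
    exact h hi
  let f : Fin m → Fin m := fun i => ⟨τ (Fin.castAdd s i), key _ (by simp)⟩
  have hf : Function.Injective f := by
    intro i j h
    have h1 : (τ (Fin.castAdd s i) : ℕ) = τ (Fin.castAdd s j) := by
      have := congrArg Fin.val h
      simpa only [f] using this
    have h2 := τ.injective (Fin.ext h1)
    simpa using h2
  refine ⟨Equiv.ofBijective f (Finite.injective_iff_bijective.mp hf), ?_⟩
  ext i
  by_cases hi : m ≤ (i:ℕ)
  · rw [liftPerm_fix _ _ hi, hτ _ hi]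
  · obtain ⟨j, rfl⟩ : ∃ j : Fin m, i = Fin.castAdd s j := ⟨⟨i, by omega⟩, by ext; simp⟩
    rw [liftPerm_castAdd]
    simp [f]

lemma xi_inj (n r : ℕ) (hr : r ≤ n)
    (x₁ x₂ a : ℂ) (hx₁ : x₁ ≠ 0) (hx₂ : x₂ ≠ 0) (ha : a ≠ 0)
    (ha1 : ∀ m : ℕ, 1 ≤ m → m ≤ n → a ^ m ≠ 1)
    (hgen : ∀ m : ℤ, |m| ≤ (n : ℤ) → x₂ ≠ x₁ * a ^ m) :
    Function.Injective (xiPt n r x₁ x₂ a) := by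
  have hpow : ∀ k l : ℕ, k < l → l ≤ n → a ^ k ≠ a ^ l := by
    intro k l hkl hl h
    apply ha1 (l - k) (by omega) (by omega)
    have h2 : a ^ l = a ^ k * a ^ (l - k) := by rw [← pow_add]; congr 1; omega
    rw [h2] at h
    exact (mul_right_eq_self₀.mp h.symm).resolve_right (pow_ne_zero _ ha)
  have hpow' : ∀ k l : ℕ, k ≤ n → l ≤ n → a ^ k = a ^ l → k = l := by
    intro k l hk hl h
    rcases lt_trichotomy k l with h1 | h1 | h1
    · exact absurd h (hpow k l h1 hl)
    · exact h1
    · exact absurd h.symm (hpow l k h1 hk)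
  have hcross : ∀ k l : ℕ, k ≤ n → l ≤ n → x₁ * a ^ k ≠ x₂ * a ^ l := by
    intro k l hk hl h
    apply hgen ((k : ℤ) - l) (by rw [abs_le]; constructor <;> omega)
    rw [zpow_sub₀ ha, zpow_natCast, zpow_natCast]
    have := pow_ne_zero l ha
    field_simp
    exact h.symm
  intro i j h
  have hi := i.2
  have hj := j.2
  unfold xiPt at h
  ext
  split_ifs at h with h1 h2 h2
  · exact hpow' _ _ hi.le hj.le (mul_left_cancel₀ hx₁ h)
  · exact absurd h (hcross _ _ hi.le (by omega))
  · exact absurd h.symm (hcross _ _ hj.le (by omega))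
  · have := hpow' _ _ (by omega) (by omega) (mul_left_cancel₀ hx₂ h)
    omega

lemma xi_ne (n r : ℕ) (x₁ x₂ a : ℂ) (hx₁ : x₁ ≠ 0) (hx₂ : x₂ ≠ 0) (ha : a ≠ 0) (i : Fin n) :
    xiPt n r x₁ x₂ a i ≠ 0 := by
  unfold xiPt
  split_ifs
  · exact mul_ne_zero hx₁ (pow_ne_zero _ ha)
  · exact mul_ne_zero hx₂ (pow_ne_zero _ ha)

lemma combi (n r s : ℕ) (hsr : s ≤ r) (hr : r ≤ n) (σ : Equiv.Perm (Fin n))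
    (h0 : ∀ i : Fin n, (σ i : ℕ) = 0 → 0 < n - r → (i : ℕ) < n - s)
    (hc : ∀ i j : Fin n, (σ j : ℕ) = σ i + 1 → ((σ j : ℕ) < n - r ∨ n - r ≤ (σ i : ℕ)) → j < i) :
    ∀ i : Fin n, n - s ≤ (i : ℕ) → (σ i : ℕ) = 2 * n - r - 1 - i := by
  -- block 1
  have hb1 : ∀ k : ℕ, k < n - r → ∀ i : Fin n, (σ i : ℕ) = k → (i : ℕ) < n - s := by
    intro k
    induction k with
    | zero => intro hk i hi; exact h0 i hi hk
    | succ k ih =>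
      intro hk i hi
      have hkn : k < n := by omega
      have e : ((σ (σ.symm ⟨k, hkn⟩) : Fin n) : ℕ) = k := by simp
      have h1 := ih (by omega) _ e
      have h2 := hc (σ.symm ⟨k, hkn⟩) i (by omega) (by omega)
      rw [Fin.lt_def] at h2
      omega
  -- block 2 antitone
  have hb2 : ∀ d : ℕ, ∀ i j : Fin n, (σ j : ℕ) = σ i + d + 1 → n - r ≤ (σ i : ℕ) → j < i := by
    intro d
    induction d with
    | zero => intro i j h h'; exact hc i j h (Or.inr h')
    | succ d ih =>
      intro i j h h'
      have hkn : (σ i : ℕ) + d + 1 < n := by have := (σ j).2; omega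
      have e : ((σ (σ.symm ⟨_, hkn⟩) : Fin n) : ℕ) = σ i + d + 1 := by simp
      have h1 := ih i _ e h'
      have h2 := hc (σ.symm ⟨_, hkn⟩) j (by omega) (by omega)
      exact h2.trans h1
  have main : ∀ k : ℕ, k < s → ∀ i : Fin n, (i : ℕ) = n - 1 - k → (σ i : ℕ) = n - r + k := by
    intro k
    induction k using Nat.strong_induction_on with
    | _ k ih =>
      intro hk i hi
      have hge : n - r ≤ (σ i : ℕ) := by
        by_contra h
        have := hb1 _ (not_le.mp h) i rfl
        omega
      rcases lt_trichotomy (σ i : ℕ) (n - r + k) with h | h | h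
      · exfalso
        have h2 := ih ((σ i : ℕ) - (n - r)) (by omega) (by omega)
          ⟨n - 1 - ((σ i : ℕ) - (n - r)), by omega⟩ rfl
        have h3 : σ ⟨n - 1 - ((σ i : ℕ) - (n - r)), by omega⟩ = σ i := by
          ext; omega
        have h4 := congrArg Fin.val (σ.injective h3)
        simp only at h4
        omega
      · exact h
      · exfalso
        have hkn : n - r + k < n := by omega
        have e : ((σ (σ.symm ⟨_, hkn⟩) : Fin n) : ℕ) = n - r + k := by simp
        have h1 := hb2 ((σ i : ℕ) - (n - r + k) - 1) (σ.symm ⟨_, hkn⟩) i (by omega) (by omega)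
        rw [Fin.lt_def] at h1
        have hl := (σ.symm ⟨_, hkn⟩).2
        have h2 := ih (n - 1 - (σ.symm ⟨_, hkn⟩ : Fin n)) (by omega) (by omega)
          (σ.symm ⟨_, hkn⟩) (by omega)
        omega
  intro i hi
  have := i.2
  have := main (n - 1 - i) (by omega) i (by omega)
  omega

lemma vanish (n r s : ℕ) (hsr : s ≤ r) (hr : r ≤ n)
    (x₁ x₂ a b₂ : ℂ) (hx₁ : x₁ ≠ 0) (ha : a ≠ 0) (σ : Equiv.Perm (Fin n))
    (h : phiFun n s x₁ x₂ b₂ (fun i => xiPt n r x₁ x₂ a (σ i)) *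
      PF a⁻¹ (fun i => xiPt n r x₁ x₂ a (σ i)) ≠ 0) :
    ∀ i : Fin n, n - s ≤ (i : ℕ) → (σ i : ℕ) = 2 * n - r - 1 - i := by
  have hphi := left_ne_zero_of_mul h
  have hPF := right_ne_zero_of_mul h
  refine combi n r s hsr hr σ ?_ ?_
  · intro i hi hnr
    by_contra hlt
    unfold phiFun at hphi
    have h2 := right_ne_zero_of_mul hphi
    rw [Finset.prod_ne_zero_iff] at h2
    apply h2 i (by simp; omega)
    simp [xiPt, hi, hnr, hx₁]
  · intro i j hij hb
    by_contra hlt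
    have hne : i ≠ j := by rintro rfl; omega
    have hlt' : i < j := lt_of_le_of_ne (not_lt.mp hlt) hne
    unfold PF at hPF
    rw [Finset.prod_ne_zero_iff] at hPF
    have h2 := hPF i (Finset.mem_univ _)
    rw [Finset.prod_ne_zero_iff] at h2
    have h3 := h2 j (Finset.mem_univ _)
    rw [if_pos hlt'] at h3
    apply h3
    have : xiPt n r x₁ x₂ a (σ j) = a * xiPt n r x₁ x₂ a (σ i) := by
      unfold xiPt
      rcases hb with hb | hb
      · rw [if_pos hb, if_pos (by omega), hij]; ring
      · rw [if_neg (by omega), if_neg (by omega), hij, Nat.sub_add_comm hb]; ring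
    have h4 : xiPt n r x₁ x₂ a (σ i) - a⁻¹ * xiPt n r x₁ x₂ a (σ j) = 0 := by
      rw [this, inv_mul_cancel_left₀ ha, sub_self]
    simp only [h4, zero_div]

lemma sum_main (m s r : ℕ) (hsr : s ≤ r) (hr : r ≤ m + s)
    (x₁ x₂ a b₂ : ℂ) (hx₁ : x₁ ≠ 0) (hx₂ : x₂ ≠ 0) (ha : a ≠ 0) (hq : a⁻¹ ≠ 1)
    (hinj : Function.Injective (xiPt (m+s) r x₁ x₂ a))
    (w : Equiv.Perm (Fin (m+s)))
    (hw : ∀ i : Fin (m+s), m ≤ (i:ℕ) → (w i : ℕ) = 2 * (m+s) - r - 1 - (i : ℕ)) :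
    ∑ σ : Equiv.Perm (Fin (m+s)), phiFun (m+s) s x₁ x₂ b₂ (fun i => xiPt (m+s) r x₁ x₂ a (σ i)) *
      PF a⁻¹ (fun i => xiPt (m+s) r x₁ x₂ a (σ i)) =
    (∏ k ∈ Finset.range m, ((1 - a⁻¹^(k+1))/(1-a⁻¹))) *
      (phiFun (m+s) s x₁ x₂ b₂ (fun i => xiPt (m+s) r x₁ x₂ a (w i)) *
        TF m a⁻¹ (fun i => xiPt (m+s) r x₁ x₂ a (w i))) := by
  have hms : m + s - s = m := by omega
  rw [← sum_PF a⁻¹ hq m (fun i => xiPt (m+s) r x₁ x₂ a (w (Fin.castAdd s i)))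
    (fun i j h => Fin.castAdd_injective _ _ (w.injective (hinj h)))
    (fun i => xi_ne _ _ _ _ _ hx₁ hx₂ ha _), Finset.sum_mul]
  symm
  refine Finset.sum_of_injOn (fun e => w * liftPerm s e) ?_ ?_ ?_ ?_
  · intro e _ e' _ h
    exact liftPerm_inj (mul_left_cancel h)
  · intro e _; simp
  · intro σ _ hσ
    by_contra hne
    apply hσ
    have hv := vanish (m+s) r s hsr hr x₁ x₂ a b₂ hx₁ ha σ hne
    rw [hms] at hv
    obtain ⟨e, he⟩ := liftPerm_surj (w⁻¹ * σ) (by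
      intro i hi
      rw [Equiv.Perm.mul_apply, Equiv.Perm.inv_eq_iff_eq]
      ext
      rw [hv i hi, hw i hi])
    exact ⟨e, by simp, by simp [he]⟩
  · intro e _
    have h1 := phi_perm s x₁ x₂ b₂ (fun i => xiPt (m+s) r x₁ x₂ a (w i)) (liftPerm s e)
      (by rw [hms]; exact liftPerm_fix e)
    have h2 := TF_perm m a⁻¹ (fun i => xiPt (m+s) r x₁ x₂ a (w i)) (liftPerm s e) (liftPerm_fix e)
    simp only [Equiv.Perm.mul_apply]
    rw [h1, PF_split, h2]
    simp only [liftPerm_castAdd]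
    ring

/-- Lemma 7.5: for `s ≤ r` the alternating sum `𝒜(φ_s·D_a)(ξ)` equals
`(a⁻¹;a⁻¹)_{n−s}/(1−a⁻¹)^{n−s} · sgn(w) · (wφ_s)(ξ) · (wG_s)(ξ)` for the shuffle `w = w_{rs}`. -/
theorem lemma7_5 (n r s : ℕ) (hn : 1 ≤ n) (hsr : s ≤ r) (hr : r ≤ n)
    (x₁ x₂ a b₂ : ℂ) (hx₁ : x₁ ≠ 0) (hx₂ : x₂ ≠ 0) (ha : a ≠ 0) (hb₂ : b₂ ≠ 0)
    (ha1 : ∀ m : ℕ, 1 ≤ m → m ≤ n → a ^ m ≠ 1)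
    (hgen : ∀ m : ℤ, |m| ≤ (n : ℤ) → x₂ ≠ x₁ * a ^ m)
    (hb₂a : ∀ m : ℕ, m ≤ n - 1 → b₂ * a ^ m ≠ 1)
    (hbx : ∀ m : ℕ, m ≤ n - 1 → b₂ * x₁ * a ^ m ≠ x₂)
    (w : Equiv.Perm (Fin n))
    (hw : ∀ i : Fin n, (w i : ℕ) =
      if (i : ℕ) < n - r then (i : ℕ)
      else if (i : ℕ) < n - s then (i : ℕ) + s
      else 2 * n - r - 1 - (i : ℕ)) :
    ∑ σ : Equiv.Perm (Fin n),
      ((Equiv.Perm.sign σ : ℤ) : ℂ) *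
        phiFun n s x₁ x₂ b₂ (fun i => xiPt n r x₁ x₂ a (σ i)) *
        ∏ p ∈ Finset.univ.filter (fun p : Fin n × Fin n => p.1 < p.2),
          (xiPt n r x₁ x₂ a (σ p.1) - a⁻¹ * xiPt n r x₁ x₂ a (σ p.2))
    = (qPoch a⁻¹ a⁻¹ (n - s) / (1 - a⁻¹) ^ (n - s)) *
        ((Equiv.Perm.sign w : ℤ) : ℂ) *
        phiFun n s x₁ x₂ b₂ (fun i => xiPt n r x₁ x₂ a (w i)) *
        Gfun n s a (fun i => xiPt n r x₁ x₂ a (w i)) := by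
  have hinj := xi_inj n r hr x₁ x₂ a hx₁ hx₂ ha ha1 hgen
  have ha' : a ≠ 1 := by simpa using ha1 1 le_rfl hn
  have hq : a⁻¹ ≠ 1 := by simpa using ha'
  have hw' : ∀ i : Fin n, n - s ≤ (i:ℕ) → (w i : ℕ) = 2 * n - r - 1 - (i : ℕ) := by
    intro i hi
    rw [hw i, if_neg (by omega), if_neg (by omega)]
  have hsq : ∀ σ : Equiv.Perm (Fin n),
      ((Equiv.Perm.sign σ : ℤ) : ℂ) * ((Equiv.Perm.sign σ : ℤ) : ℂ) = 1 := by
    intro σ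
    rw [← Int.cast_mul, ← Units.val_mul, Int.units_mul_self]
    simp
  have hL : ∀ σ : Equiv.Perm (Fin n), ((Equiv.Perm.sign σ : ℤ) : ℂ) *
        phiFun n s x₁ x₂ b₂ (fun i => xiPt n r x₁ x₂ a (σ i)) *
        ∏ p ∈ Finset.univ.filter (fun p : Fin n × Fin n => p.1 < p.2),
          (xiPt n r x₁ x₂ a (σ p.1) - a⁻¹ * xiPt n r x₁ x₂ a (σ p.2)) =
      VF (xiPt n r x₁ x₂ a) * (phiFun n s x₁ x₂ b₂ (fun i => xiPt n r x₁ x₂ a (σ i)) *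
        PF a⁻¹ (fun i => xiPt n r x₁ x₂ a (σ i))) := by
    intro σ
    rw [D_eq a⁻¹ (fun i => xiPt n r x₁ x₂ a (σ i)) (hinj.comp σ.injective), VF_perm]
    linear_combination (VF (xiPt n r x₁ x₂ a) *
      (phiFun n s x₁ x₂ b₂ (fun i => xiPt n r x₁ x₂ a (σ i)) *
        PF a⁻¹ (fun i => xiPt n r x₁ x₂ a (σ i)))) * hsq σ
  rw [Finset.sum_congr rfl (fun σ _ => hL σ), ← Finset.mul_sum,
    G_eq s a (fun i => xiPt n r x₁ x₂ a (w i)) (hinj.comp w.injective), VF_perm]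
  have hQ : qPoch a⁻¹ a⁻¹ (n - s) / (1 - a⁻¹) ^ (n - s) =
      ∏ k ∈ Finset.range (n - s), ((1 - a⁻¹^(k+1))/(1-a⁻¹)) := by
    unfold qPoch
    rw [Finset.prod_div_distrib]
    simp [pow_succ]
  rw [hQ]
  have hS : ∑ σ : Equiv.Perm (Fin n), phiFun n s x₁ x₂ b₂ (fun i => xiPt n r x₁ x₂ a (σ i)) *
      PF a⁻¹ (fun i => xiPt n r x₁ x₂ a (σ i)) =
    (∏ k ∈ Finset.range (n - s), ((1 - a⁻¹^(k+1))/(1-a⁻¹))) *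
      (phiFun n s x₁ x₂ b₂ (fun i => xiPt n r x₁ x₂ a (w i)) *
        TF (n - s) a⁻¹ (fun i => xiPt n r x₁ x₂ a (w i))) := by
    clear hL hsq hQ hw hgen ha1 hb₂a hbx
    obtain ⟨m, rfl⟩ : ∃ m, n = m + s := ⟨n - s, by omega⟩
    have hms : m + s - s = m := by omega
    simp only [hms] at hw' ⊢
    exact sum_main m s r hsr hr x₁ x₂ a b₂ hx₁ hx₂ ha hq hinj w hw'
  rw [hS]
  generalize (∏ k ∈ Finset.range (n - s), ((1 - a⁻¹^(k+1))/(1-a⁻¹))) = Q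
  generalize phiFun n s x₁ x₂ b₂ (fun i => xiPt n r x₁ x₂ a (w i)) = A
  generalize TF (n - s) a⁻¹ (fun i => xiPt n r x₁ x₂ a (w i)) = B
  linear_combination (-(VF (xiPt n r x₁ x₂ a) * Q * A * B)) * hsq w
end

section
/- Fix n ≥ 1, 0 ≤ s ≤ r ≤ n, and a nonzero complex parameter a. Let w = w_{rs} ∈ S_n be defined by w(i) = i for 1 ≤ i ≤ n−r, w(i) = i+s for n−r+1 ≤ i ≤ n−s, and w(i) = 2n−r+1−i for n−s+1 ≤ i ≤ n, and let G_s(t₁,…,t_n) := ∏_{1≤i<j≤n−s}(t_i − t_j) · ∏_{1≤i≤n−s<j≤n}(t_i − a^{−1}t_j) · ∏_{n−s+1≤i<j≤n}(t_i − a^{−1}t_j). Then for all nonzero t₁,…,t_n: (t₁^{n−1} t₂^{n−2} ⋯ t_{n−1})^{−1} · sgn(w) · G_s(t_{w(1)},…,t_{w(n)}) = a^{−s(2r−s−1)/2} · ∏_{1≤i<j≤n} (1 − d_{ij} t_j/t_i), where d_{ij} = a^{−1} if 1 ≤ i ≤ n−r and n−r+1 ≤ j ≤ n−r+s, d_{ij}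 = a if n−r+1 ≤ i ≤ n−r+s and i < j ≤ n, and d_{ij} = 1 otherwise. (Proposition 7.7, with a^{−1} playing the role of q^{−γ}.) -/
open Finset

/-- The coefficient `d_{ij}` of Proposition 7.7 (`a⁻¹` playing the role of `q^{−γ}`),
for the zero-based pair `(i,j)`, `i < j`. -/
noncomputable def dCoef (n r s : ℕ) (a : ℂ) (p : Fin n × Fin n) : ℂ :=
  if (p.1 : ℕ) < n - r ∧ n - r ≤ (p.2 : ℕ) ∧ (p.2 : ℕ) < n - r + s then a⁻¹
  else if n - r ≤ (p.1 : ℕ) ∧ (p.1 : ℕ) < n - r + s then a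
  else 1

lemma aux_reindex (n : ℕ) (w : Equiv.Perm (Fin n)) (F : Fin n × Fin n → ℂ) :
    ∏ p ∈ Finset.univ.filter (fun p : Fin n × Fin n => p.1 < p.2),
      F (min (w p.1) (w p.2), max (w p.1) (w p.2)) =
    ∏ p ∈ Finset.univ.filter (fun p : Fin n × Fin n => p.1 < p.2), F p := by
  have key : ∀ (w : Equiv.Perm (Fin n)) (p : Fin n × Fin n), p.1 < p.2 →
      min (w p.1) (w p.2) < max (w p.1) (w p.2) := by
    intro w p hp
    rw [min_lt_max]
    exact fun h => hp.ne (w.injective h)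
  have inv : ∀ (w : Equiv.Perm (Fin n)) (p : Fin n × Fin n), p.1 < p.2 →
      (min (w.symm (min (w p.1) (w p.2))) (w.symm (max (w p.1) (w p.2))),
       max (w.symm (min (w p.1) (w p.2))) (w.symm (max (w p.1) (w p.2)))) = p := by
    intro w p hp
    rcases le_total (w p.1) (w p.2) with h | h
    · simp [h, hp.le]
    · simp [h, hp.le]
  refine Finset.prod_nbij' (fun p => (min (w p.1) (w p.2), max (w p.1) (w p.2)))
    (fun p => (min (w.symm p.1) (w.symm p.2), max (w.symm p.1) (w.symm p.2))) ?_ ?_ ?_ ?_ ?_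
  · intro p hp
    simp only [Finset.mem_filter, Finset.mem_univ, true_and] at hp ⊢
    exact key w p hp
  · intro p hp
    simp only [Finset.mem_filter, Finset.mem_univ, true_and] at hp ⊢
    exact key w.symm p hp
  · intro p hp
    simp only [Finset.mem_filter, Finset.mem_univ, true_and] at hp
    exact inv w p hp
  · intro p hp
    simp only [Finset.mem_filter, Finset.mem_univ, true_and] at hp
    exact inv w.symm p hp
  · intro p hp
    rfl

lemma aux_Ioi {M : Type*} [CommMonoid M] (n : ℕ) (F : Fin n × Fin n → M) :
    ∏ p ∈ Finset.univ.filter (fun p : Fin n × Fin n => p.1 < p.2), F p =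
    ∏ i : Fin n, ∏ j ∈ Finset.Ioi i, F (i, j) := by
  rw [Finset.prod_filter, Fintype.prod_prod_type]
  refine Finset.prod_congr rfl fun i _ => ?_
  rw [← Finset.prod_filter]
  refine Finset.prod_congr ?_ fun _ _ => rfl
  ext j; simp

lemma aux_Iio {M : Type*} [CommMonoid M] (n : ℕ) (F : Fin n × Fin n → M) :
    ∏ p ∈ Finset.univ.filter (fun p : Fin n × Fin n => p.1 < p.2), F p =
    ∏ j : Fin n, ∏ i ∈ Finset.Iio j, F (i, j) := by
  rw [Finset.prod_filter, Fintype.prod_prod_type_right]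
  refine Finset.prod_congr rfl fun i _ => ?_
  rw [← Finset.prod_filter]
  refine Finset.prod_congr ?_ fun _ _ => rfl
  ext j; simp

lemma aux_count (n r s : ℕ) (hsr : s ≤ r) (hr : r ≤ n) (b : ℂ) :
    ∏ p ∈ Finset.univ.filter (fun p : Fin n × Fin n => p.1 < p.2),
      (if n - r ≤ (p.1 : ℕ) ∧ n - s ≤ (p.2 : ℕ) then b else 1) =
    b ^ (s * (2 * r - s - 1) / 2) := by
  rw [aux_Iio]
  have h1 : ∀ j : Fin n, (∏ i ∈ Finset.Iio j,
      (if n - r ≤ (i : ℕ) ∧ n - s ≤ (j : ℕ) then b else 1)) =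
      (fun k : ℕ => if n - s ≤ k then b ^ (k - (n - r)) else 1) (j : ℕ) := by
    intro j
    by_cases hj : n - s ≤ (j : ℕ)
    · have hlt : n - r < n := by omega
      simp only [hj, and_true, if_true]
      rw [← Finset.prod_filter, Finset.prod_const]
      congr 1
      have : Finset.filter (fun i : Fin n => n - r ≤ (i : ℕ)) (Finset.Iio j) =
          Finset.Ico (⟨n - r, hlt⟩ : Fin n) j := by
        ext i
        simp [Fin.le_def, and_comm]
      rw [this, Fin.card_Ico]
    · simp [hj]
  simp only [h1]
  rw [Fin.prod_univ_eq_prod_range (fun k : ℕ => if n - s ≤ k then b ^ (k - (n - r)) else 1) n]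
  obtain ⟨m, rfl⟩ : ∃ m, n = m + s := ⟨n - s, by omega⟩
  rw [Finset.prod_range_add]
  have h2 : ∏ x ∈ Finset.range m,
      (if m + s - s ≤ x then b ^ (x - (m + s - r)) else 1) = 1 := by
    refine Finset.prod_eq_one fun x hx => ?_
    rw [Finset.mem_range] at hx
    rw [if_neg (by omega)]
  rw [h2, one_mul]
  obtain ⟨d, rfl⟩ : ∃ d, r = s + d := ⟨r - s, by omega⟩
  have h3 : ∀ x ∈ Finset.range s,
      (if m + s - s ≤ m + x then b ^ (m + x - (m + s - (s + d))) else 1) = b ^ (d + x) := by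
    intro x hx
    rw [if_pos (by omega)]
    congr 1
    omega
  rw [Finset.prod_congr rfl h3, Finset.prod_pow_eq_pow_sum]
  congr 1
  rw [Finset.sum_add_distrib, Finset.sum_const, Finset.card_range, smul_eq_mul]
  have h4 := Finset.sum_range_id_mul_two s
  have h5 : s * (2 * (s + d) - s - 1) = 2 * (s * d) + s * (s - 1) := by
    rcases s with _ | s
    · simp
    · have : 2 * (s + 1 + d) - (s + 1) - 1 = 2 * d + s := by omega
      rw [this]; simp; ring
  rw [h5]
  omega

lemma aux_sign (n : ℕ) (w : Equiv.Perm (Fin n)) :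
    ((Equiv.Perm.sign w : ℤ) : ℂ) =
    ∏ p ∈ Finset.univ.filter (fun p : Fin n × Fin n => p.1 < p.2),
      (if w p.1 < w p.2 then (1 : ℂ) else -1) := by
  rw [aux_Ioi, Equiv.Perm.sign_eq_prod_prod_Ioi]
  push_cast
  refine Finset.prod_congr rfl fun i _ => Finset.prod_congr rfl fun j _ => ?_
  split_ifs <;> simp

/-- Proposition 7.7:
`(t₁^{n−1}⋯t_{n−1})⁻¹ · sgn(w) · G_s(t_{w(1)},…,t_{w(n)})
  = a^{−s(2r−s−1)/2} ∏_{i<j} (1 − d_{ij} t_j/t_i)`. -/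
theorem prop7_7 (n r s : ℕ) (hn : 1 ≤ n) (hsr : s ≤ r) (hr : r ≤ n)
    (a : ℂ) (ha : a ≠ 0)
    (w : Equiv.Perm (Fin n))
    (hw : ∀ i : Fin n, (w i : ℕ) =
      if (i : ℕ) < n - r then (i : ℕ)
      else if (i : ℕ) < n - s then (i : ℕ) + s
      else 2 * n - r - 1 - (i : ℕ))
    (t : Fin n → ℂ) (ht : ∀ i, t i ≠ 0) :
    (∏ i : Fin n, t i ^ (n - 1 - (i : ℕ)))⁻¹ * ((Equiv.Perm.sign w : ℤ) : ℂ) *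
        Gfun n s a (fun i => t (w i))
    = a ^ (-((s * (2 * r - s - 1) / 2 : ℕ) : ℤ)) *
        ∏ p ∈ Finset.univ.filter (fun p : Fin n × Fin n => p.1 < p.2),
          (1 - dCoef n r s a p * t p.2 / t p.1) := by
  have hmon : ∏ i : Fin n, t i ^ (n - 1 - (i : ℕ)) =
      ∏ p ∈ Finset.univ.filter (fun p : Fin n × Fin n => p.1 < p.2), t p.1 := by
    rw [aux_Ioi]
    refine Finset.prod_congr rfl fun i _ => ?_
    simp
  have hmon0 : ∏ i : Fin n, t i ^ (n - 1 - (i : ℕ)) ≠ 0 :=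
    Finset.prod_ne_zero_iff.mpr fun i _ => pow_ne_zero _ (ht i)
  have hinvert : ∀ p : Fin n × Fin n, p.1 < p.2 →
      (w p.1 < w p.2 ↔ ¬ (n - r ≤ (p.1 : ℕ) ∧ n - s ≤ (p.2 : ℕ))) := by
    rintro ⟨p, q⟩ hpq
    have hp := p.2
    have hq := q.2
    simp only [Fin.lt_def] at hpq ⊢
    rw [hw p, hw q]
    split_ifs <;> omega
  have hG : ((Equiv.Perm.sign w : ℤ) : ℂ) * Gfun n s a (fun i => t (w i)) =
      ∏ p ∈ Finset.univ.filter (fun p : Fin n × Fin n => p.1 < p.2),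
        ((if n - r ≤ (p.1 : ℕ) ∧ n - s ≤ (p.2 : ℕ) then a⁻¹ else 1) *
        (fun q : Fin n × Fin n => t q.1 * (1 - dCoef n r s a q * t q.2 / t q.1))
          (min (w p.1) (w p.2), max (w p.1) (w p.2))) := by
    rw [aux_sign, Gfun, ← Finset.prod_mul_distrib]
    refine Finset.prod_congr rfl fun p hp => ?_
    simp only [Finset.mem_filter, Finset.mem_univ, true_and] at hp
    have hi := hinvert p hp
    obtain ⟨p, q⟩ := p
    have hp2 := p.2
    have hq2 := q.2
    have hwp := hw p
    have hwq := hw q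
    simp only [Fin.lt_def] at hp
    simp only at hi ⊢
    have tp := ht (w p)
    have tq := ht (w q)
    by_cases h : n - r ≤ (p : ℕ) ∧ n - s ≤ (q : ℕ)
    · have hlt : ¬ w p < w q := by rw [hi]; exact not_not.mpr h
      have hle : w q ≤ w p := not_lt.mp hlt
      rw [if_neg hlt, if_pos h, if_neg (by omega), min_eq_right hle, max_eq_left hle]
      have hd : dCoef n r s a (w q, w p) = a := by
        rw [if_neg (by omega : ¬ (q : ℕ) < n - r), if_neg (by omega : ¬ (q : ℕ) < n - s)] at hwq
        simp only [dCoef]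
        rw [if_neg (by omega), if_pos (by omega)]
      rw [hd]
      field_simp
      ring
    · have hlt : w p < w q := by rw [hi]; exact h
      have hle : w p ≤ w q := hlt.le
      rw [if_pos hlt, if_neg h, min_eq_left hle, max_eq_right hle]
      have hd : dCoef n r s a (w p, w q) = if (q : ℕ) < n - s then 1 else a⁻¹ := by
        simp only [dCoef]
        by_cases hq : (q : ℕ) < n - s
        · rw [if_pos hq]
          rw [if_neg, if_neg]
          · split_ifs at hwp <;> omega
          · split_ifs at hwq <;> omega
        · rw [if_neg hq, if_pos]
          rw [if_neg (by omega : ¬ (q : ℕ) < n - r), if_neg hq] at hwq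
          rw [if_pos (by omega : (p : ℕ) < n - r)] at hwp
          omega
      rw [hd]
      generalize (if (q : ℕ) < n - s then (1 : ℂ) else a⁻¹) = c
      field_simp
  rw [mul_assoc, hG, Finset.prod_mul_distrib, aux_count n r s hsr hr,
    aux_reindex n w (fun q : Fin n × Fin n => t q.1 * (1 - dCoef n r s a q * t q.2 / t q.1)),
    Finset.prod_mul_distrib, ← hmon, zpow_neg, zpow_natCast, inv_pow]
  field_simp
end

section
/- Fix n ≥ 1, 0 ≤ r ≤ n, 0 ≤ s ≤ n, and nonzero complex numbers x₁, x₂, a, b₁, b₂ with a^m ≠ 1 for 1 ≤ m ≤ n−1, b₁ a^m ≠ 1 for 0 ≤ m ≤ n−1, x₂ b₁ ≠ x₁ b₂ a^m for |m| ≤ n, and x₂ ≠ x₁ b₂ a^m for |m| ≤ n. Then for every σ ∈ S_n one has (σφ_s)(η) := ∏_{i=1}^{n−s}(1 − b₂ η_{σ(i)}/x₂) · ∏_{i=n−s+1}^{n}(1 − η_{σ(i)}/x₁) = 0 if and only if there exists i with 1 ≤ i ≤ n−s and σ(i) = n−r+1. (Lemma 8.3.) -/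
open Finset

/-- The characteristic point `η = η_r ∈ ℂⁿ`: `η_i = x₁ b₁⁻¹ a^{−(i−1)}` for `1 ≤ i ≤ n−r`
and `η_{n−r+i} = x₂ b₂⁻¹ a^{−(i−1)}` for `1 ≤ i ≤ r` (indexed by `Fin n`, zero-based). -/
noncomputable def etaPt (n r : ℕ) (x₁ x₂ a b₁ b₂ : ℂ) (i : Fin n) : ℂ :=
  if (i : ℕ) < n - r then x₁ * b₁⁻¹ * (a ^ (i : ℕ))⁻¹
  else x₂ * b₂⁻¹ * (a ^ ((i : ℕ) - (n - r)))⁻¹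

/-- Lemma 8.3: `(σφ_s)(η) = 0` iff `σ(i) = n−r+1` for some `i` with `1 ≤ i ≤ n−s`
(zero-based: `σ i = n−r` for some `i < n−s`). -/
theorem lemma8_3 (n r s : ℕ) (hn : 1 ≤ n) (hr : r ≤ n) (hs : s ≤ n)
    (x₁ x₂ a b₁ b₂ : ℂ) (hx₁ : x₁ ≠ 0) (hx₂ : x₂ ≠ 0) (ha : a ≠ 0)
    (hb₁ : b₁ ≠ 0) (hb₂ : b₂ ≠ 0)
    (ha1 : ∀ m : ℕ, 1 ≤ m → m ≤ n - 1 → a ^ m ≠ 1)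
    (hb₁a : ∀ m : ℕ, m ≤ n - 1 → b₁ * a ^ m ≠ 1)
    (hgen : ∀ m : ℤ, |m| ≤ (n : ℤ) → x₂ * b₁ ≠ x₁ * b₂ * a ^ m)
    (hgen' : ∀ m : ℤ, |m| ≤ (n : ℤ) → x₂ ≠ x₁ * b₂ * a ^ m)
    (σ : Equiv.Perm (Fin n)) :
    phiFun n s x₁ x₂ b₂ (fun i => etaPt n r x₁ x₂ a b₁ b₂ (σ i)) = 0
    ↔ ∃ i : Fin n, (i : ℕ) < n - s ∧ (σ i : ℕ) = n - r := by
  have h1 : ∀ j : Fin n, 1 - b₂ * etaPt n r x₁ x₂ a b₁ b₂ j / x₂ = 0 ↔ (j : ℕ) = n - r := by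
    intro j
    have hj := j.isLt
    unfold etaPt
    split_ifs with h
    · have hp : a ^ (j : ℕ) ≠ 0 := pow_ne_zero _ ha
      refine ⟨fun h0 => ?_, fun h0 => by omega⟩
      exfalso
      apply hgen (-((j : ℕ) : ℤ)) (by rw [abs_neg, Nat.abs_cast]; omega)
      rw [zpow_neg, zpow_natCast]
      field_simp at h0 ⊢
      linear_combination h0
    · have hp : a ^ ((j : ℕ) - (n - r)) ≠ 0 := pow_ne_zero _ ha
      constructor
      · intro h0
        by_contra hne
        apply ha1 ((j : ℕ) - (n - r)) (by omega) (by omega)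
        field_simp at h0
        linear_combination h0
      · intro h0
        rw [h0]
        simp
        field_simp
        simp
  have h2 : ∀ j : Fin n, 1 - etaPt n r x₁ x₂ a b₁ b₂ j / x₁ ≠ 0 := by
    intro j h0
    have hj := j.isLt
    unfold etaPt at h0
    split_ifs at h0 with h
    · have hp : a ^ (j : ℕ) ≠ 0 := pow_ne_zero _ ha
      apply hb₁a (j : ℕ) (by omega)
      field_simp at h0
      linear_combination h0
    · have hp : a ^ ((j : ℕ) - (n - r)) ≠ 0 := pow_ne_zero _ ha
      apply hgen' (((j : ℕ) - (n - r) : ℕ) : ℤ) (by rw [Nat.abs_cast]; omega)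
      rw [zpow_natCast]
      field_simp at h0
      linear_combination -h0
  unfold phiFun
  rw [mul_eq_zero, Finset.prod_eq_zero_iff, Finset.prod_eq_zero_iff]
  simp [h1, h2]
end

section
/- Fix n ≥ 1, 0 ≤ s < r ≤ n, and nonzero complex numbers x₁, x₂, a, b₁, b₂ with a^m ≠ 1 for all 1 ≤ m ≤ n and x₂ b₁ ≠ x₁ b₂ a^m for every integer m with |m| ≤ n. Then the alternating sum vanishes: 𝒜(φ_s·D_a)(η) := Σ_{σ∈S_n} sgn(σ) · φ_s(η_{σ(1)},…,η_{σ(n)}) · ∏_{1≤i<j≤n}(η_{σ(i)} − a^{−1} η_{σ(j)}) = 0. (Lemma 8.4; equivalently, the coefficient matrix C_A⁻ of Proposition 3.2 is upper triangular.) -/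
open Finset

/-- Lemma 8.4: for `s < r` the alternating sum `𝒜(φ_s·D_a)(η)` vanishes; equivalently
the coefficient matrix `C_A⁻` of Proposition 3.2 is upper triangular. -/
theorem lemma8_4 (n r s : ℕ) (hn : 1 ≤ n) (hsr : s < r) (hr : r ≤ n)
    (x₁ x₂ a b₁ b₂ : ℂ) (hx₁ : x₁ ≠ 0) (hx₂ : x₂ ≠ 0) (ha : a ≠ 0)
    (hb₁ : b₁ ≠ 0) (hb₂ : b₂ ≠ 0)
    (ha1 : ∀ m : ℕ, 1 ≤ m → m ≤ n → a ^ m ≠ 1)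
    (hgen : ∀ m : ℤ, |m| ≤ (n : ℤ) → x₂ * b₁ ≠ x₁ * b₂ * a ^ m) :
    ∑ σ : Equiv.Perm (Fin n),
      ((Equiv.Perm.sign σ : ℤ) : ℂ) *
        phiFun n s x₁ x₂ b₂ (fun i => etaPt n r x₁ x₂ a b₁ b₂ (σ i)) *
        ∏ p ∈ Finset.univ.filter (fun p : Fin n × Fin n => p.1 < p.2),
          (etaPt n r x₁ x₂ a b₁ b₂ (σ p.1) - a⁻¹ * etaPt n r x₁ x₂ a b₁ b₂ (σ p.2))
    = 0 := by
  refine Finset.sum_eq_zero fun σ _ => ?_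
  by_contra hne
  have hD := right_ne_zero_of_mul hne
  have hphi := right_ne_zero_of_mul (left_ne_zero_of_mul hne)
  have key : ∀ k : ℕ, ∀ hk : n - r + k < n, n - s + k ≤ ((σ.symm ⟨n - r + k, hk⟩ : Fin n) : ℕ) := by
    intro k
    induction k with
    | zero =>
      intro hk
      by_contra hlt
      push Not at hlt
      have h1 := left_ne_zero_of_mul hphi
      rw [Finset.prod_ne_zero_iff] at h1
      refine h1 (σ.symm ⟨n - r + 0, hk⟩) (by simpa using hlt) ?_
      simp [etaPt]
      field_simp
      simp
    | succ k ih =>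
      intro hk
      have hk' : n - r + k < n := by omega
      have h0 := ih hk'
      by_contra hlt
      have hle : ((σ.symm ⟨n - r + (k + 1), hk⟩ : Fin n) : ℕ)
          ≤ ((σ.symm ⟨n - r + k, hk'⟩ : Fin n) : ℕ) := by omega
      have hneq : (σ.symm ⟨n - r + (k + 1), hk⟩ : Fin n) ≠ σ.symm ⟨n - r + k, hk'⟩ := by
        intro h
        have := σ.symm.injective h
        simp at this
      have hlt' : (σ.symm ⟨n - r + (k + 1), hk⟩ : Fin n) < σ.symm ⟨n - r + k, hk'⟩ :=
        lt_of_le_of_ne hle hneq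
      rw [Finset.prod_ne_zero_iff] at hD
      refine hD (σ.symm ⟨n - r + (k + 1), hk⟩, σ.symm ⟨n - r + k, hk'⟩) (by simpa using hlt') ?_
      simp [etaPt]
      field_simp
      simp
      right
      ring
  have h := key (r - 1) (by omega)
  have h2 := (σ.symm ⟨n - r + (r - 1), by omega⟩ : Fin n).isLt
  omega
end

section
/- Fix n ≥ 1, 0 ≤ r ≤ s ≤ n, and nonzero complex numbers x₁, x₂, a, b₁, b₂ with a^m ≠ 1 for 1 ≤ m ≤ n, b₁ a^m ≠ 1 for 0 ≤ m ≤ n−1, x₂ b₁ ≠ x₁ b₂ a^m for |m| ≤ n, and x₂ ≠ x₁ b₂ a^m for |m| ≤ n. Then 𝒜(φ_s·D_a)(η) = [(a^{−1};a^{−1})_s / (1−a^{−1})^s] · φ_s(η) · ∏_{1≤i<j≤n, i≤n−s} (η_i − a^{−1} η_j) · ∏_{n−s+1≤i<j≤n} (η_i − η_j). (Lemma 8.5.) -/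
open Finset

open Equiv in
theorem sum_perm_split {n : ℕ} (F : Perm (Fin (n + 1)) → ℂ) :
    ∑ σ, F σ = ∑ p : Fin (n + 1), ∑ e : Perm (Fin n), F (Perm.decomposeFin.symm (p, e)) := by
  rw [← Fintype.sum_prod_type' (fun p e => F (Perm.decomposeFin.symm (p, e)))]
  exact (Equiv.sum_comp Perm.decomposeFin.symm F).symm

/-- Product over pairs. -/
noncomputable def pairProd (n : ℕ) (c : Fin n → ℂ) (t : Fin n → ℂ) : ℂ :=
  ∏ i : Fin n, ∏ j ∈ Finset.Ioi i, (t i - c i * t j)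

theorem pairProd_eq (n : ℕ) (c : Fin n → ℂ) (t : Fin n → ℂ) :
    ∏ p ∈ Finset.univ.filter (fun p : Fin n × Fin n => p.1 < p.2), (t p.1 - c p.1 * t p.2)
      = pairProd n c t := by
  unfold pairProd
  rw [Finset.prod_filter, Fintype.prod_prod_type]
  refine Finset.prod_congr rfl fun i _ => ?_
  rw [← Finset.prod_filter]
  refine Finset.prod_congr ?_ fun _ _ => rfl
  ext j; simp

theorem pairProd_succ (n : ℕ) (c : Fin (n + 1) → ℂ) (t : Fin (n + 1) → ℂ) :
    pairProd (n + 1) c t = (∏ j : Fin n, (t 0 - c 0 * t j.succ)) *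
      pairProd n (fun i => c i.succ) (fun i => t i.succ) := by
  unfold pairProd
  rw [Fin.prod_univ_succ, Fin.prod_Ioi_zero]
  simp only [Fin.prod_Ioi_succ]

theorem pairProd_perm (n : ℕ) (t : Fin n → ℂ) (σ : Equiv.Perm (Fin n)) :
    pairProd n (fun _ => 1) (fun i => t (σ i)) =
      ((Equiv.Perm.sign σ : ℤ) : ℂ) * pairProd n (fun _ => 1) t := by
  have h : ∀ u : Fin n → ℂ, pairProd n (fun _ => 1) u =
      (Matrix.vandermonde (fun i => - u i)).det := by
    intro u
    rw [Matrix.det_vandermonde]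
    unfold pairProd
    refine Finset.prod_congr rfl fun i _ => Finset.prod_congr rfl fun j _ => by ring
  rw [h, h, ← Matrix.det_permute]
  rfl

theorem lag (n : ℕ) (t : Fin n → ℂ) (c : ℂ) (ht : Function.Injective t) (h0 : ∀ i, t i ≠ 0)
    (hc : c ≠ 1) :
    ∑ p, ∏ j, (if j = p then 1 else (t p - c * t j) / (t p - t j)) = (1 - c ^ n) / (1 - c) := by
  have hc' : 1 - c ≠ 0 := sub_ne_zero.mpr (Ne.symm hc)
  let P : Polynomial ℂ := ∏ j, (Polynomial.X - Polynomial.C (c * t j))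
  let v : Fin (n + 1) → ℂ := Fin.cons 0 t
  have hv : Function.Injective v := by
    rw [Fin.cons_injective_iff]
    refine ⟨?_, ht⟩
    rintro ⟨i, hi⟩
    exact h0 i hi
  have hmon : P.Monic := Polynomial.monic_prod_X_sub_C _ _
  have hdeg : P.degree = (n : ℕ) := by
    rw [Polynomial.degree_eq_natDegree hmon.ne_zero]
    congr 1
    exact (Polynomial.natDegree_finsetProd_X_sub_C_eq_card _ _).trans (by simp)
  have key := Lagrange.leadingCoeff_eq_sum (s := Finset.univ) (v := v) (P := P) hv.injOn
    (by rw [hdeg]; simp)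
  have her : ∀ i, ∏ j ∈ Finset.univ.erase i, (v i - v j) =
      ∏ j, (if j = i then 1 else v i - v j) := by
    intro i
    rw [← Finset.mul_prod_erase Finset.univ _ (Finset.mem_univ i), if_pos rfl, one_mul]
    refine Finset.prod_congr rfl fun j hj => ?_
    rw [if_neg (Finset.ne_of_mem_erase hj)]
  simp only [her] at key
  rw [hmon.leadingCoeff, Fin.sum_univ_succ] at key
  have hev : ∀ x, P.eval x = ∏ j, (x - c * t j) := by
    intro x; simp [P, Polynomial.eval_prod]
  have hz : P.eval (v 0) / ∏ j, (if j = 0 then 1 else v 0 - v j) = c ^ n := by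
    rw [hev, Fin.prod_univ_succ, if_pos rfl, one_mul, ← Finset.prod_div_distrib]
    rw [Finset.prod_congr rfl (g := fun _ => c)]
    · simp
    · intro j _
      have := h0 j
      rw [if_neg (Fin.succ_ne_zero j)]
      simp only [v, Fin.cons_zero, Fin.cons_succ]
      field_simp
      simp
  have hi : ∀ i : Fin n, P.eval (v i.succ) / ∏ j, (if j = i.succ then 1 else v i.succ - v j) =
      (1 - c) * ∏ j, (if j = i then 1 else (t i - c * t j) / (t i - t j)) := by
    intro i
    have h1 : P.eval (v i.succ) = (t i - c * t i) * ∏ j, (if j = i then 1 else (t i - c * t j)) := by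
      rw [hev, ← Finset.mul_prod_erase Finset.univ _ (Finset.mem_univ i)]
      rw [← Finset.mul_prod_erase Finset.univ (fun j => if j = i then 1 else _) (Finset.mem_univ i),
        if_pos rfl, one_mul]
      simp only [v, Fin.cons_succ]
      congr 1
      refine Finset.prod_congr rfl fun j hj => ?_
      rw [if_neg (Finset.ne_of_mem_erase hj)]
    rw [h1, Fin.prod_univ_succ, if_neg (Fin.succ_ne_zero i).symm]
    simp only [v, Fin.cons_zero, Fin.cons_succ, Fin.succ_inj, sub_zero]
    have h2 : ∀ j, (if j = i then (1:ℂ) else (t i - c * t j) / (t i - t j)) =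
        (if j = i then 1 else (t i - c * t j)) / (if j = i then 1 else (t i - t j)) := by
      intro j; split_ifs <;> simp
    simp only [h2, Finset.prod_div_distrib]
    have := h0 i
    rw [mul_div_mul_comm]
    congr 1
    field_simp
  rw [hz] at key
  simp only [hi] at key
  rw [← Finset.mul_sum] at key
  field_simp
  linear_combination -key

theorem swap_prod (n : ℕ) (p : Fin (n + 1)) (F : Fin (n + 1) → ℂ) :
    ∏ j, (if j = p then 1 else F j) = ∏ k : Fin n, F (Equiv.swap 0 p k.succ) := by
  rw [← Equiv.prod_comp (Equiv.swap 0 p), Fin.prod_univ_succ]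
  rw [Equiv.swap_apply_left, if_pos rfl, one_mul]
  refine Finset.prod_congr rfl fun k _ => ?_
  rw [if_neg]
  intro h
  have : k.succ = 0 := by
    apply (Equiv.swap 0 p).injective
    rw [h, Equiv.swap_apply_left]
  exact Fin.succ_ne_zero _ this

/-- The constant. -/
noncomputable def kConst (c : ℂ) (s : ℕ) : ℂ := qPoch c c s / (1 - c) ^ s

theorem kConst_succ (c : ℂ) (s : ℕ) :
    kConst c (s + 1) = kConst c s * ((1 - c ^ (s + 1)) / (1 - c)) := by
  unfold kConst qPoch
  rw [Finset.prod_range_succ, pow_succ, pow_succ]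
  rw [mul_div_mul_comm]

theorem sign_cast (n : ℕ) (p : Fin (n + 1)) (e : Equiv.Perm (Fin n)) :
    ((Equiv.Perm.sign (Equiv.Perm.decomposeFin.symm (p, e)) : ℤ) : ℂ) =
    ((Equiv.Perm.sign (Equiv.swap 0 p) : ℤ) : ℂ) * ((Equiv.Perm.sign e : ℤ) : ℂ) := by
  rw [Equiv.Perm.decomposeFin.symm_sign]
  by_cases h : p = 0
  · subst h; simp
  · rw [Equiv.Perm.sign_swap (Ne.symm h), if_neg h]; simp

theorem antisym (c : ℂ) (hc : c ≠ 1) (n : ℕ) : ∀ (t : Fin n → ℂ), Function.Injective t →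
    (∀ i, t i ≠ 0) →
    ∑ σ : Equiv.Perm (Fin n), ((Equiv.Perm.sign σ : ℤ) : ℂ) *
      pairProd n (fun _ => c) (fun i => t (σ i)) = kConst c n * pairProd n (fun _ => 1) t := by
  induction n with
  | zero => intro t _ _; simp [pairProd, kConst, qPoch]
  | succ n ih =>
    intro t ht h0
    rw [sum_perm_split, kConst_succ, ← lag (n + 1) t c ht h0 hc, Finset.mul_sum, Finset.sum_mul]
    refine Finset.sum_congr rfl fun p _ => ?_
    rw [swap_prod n p (fun j => (t p - c * t j) / (t p - t j))]
    have hsw : Function.Injective (fun k : Fin n => t (Equiv.swap 0 p k.succ)) := fun x y h =>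
      Fin.succ_injective _ ((Equiv.swap 0 p).injective (ht h))
    have IH := ih (fun k => t (Equiv.swap 0 p k.succ)) hsw (fun _ => h0 _)
    have hV := pairProd_perm (n + 1) t (Equiv.swap 0 p)
    rw [pairProd_succ] at hV
    simp only [Equiv.swap_apply_left, one_mul] at hV
    have hterm : ∀ e : Equiv.Perm (Fin n),
        ((Equiv.Perm.sign (Equiv.Perm.decomposeFin.symm (p, e)) : ℤ) : ℂ) *
          pairProd (n + 1) (fun _ => c) (fun i => t (Equiv.Perm.decomposeFin.symm (p, e) i)) =
        (((Equiv.Perm.sign (Equiv.swap 0 p) : ℤ) : ℂ) *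
          ∏ k : Fin n, (t p - c * t (Equiv.swap 0 p k.succ))) *
        (((Equiv.Perm.sign e : ℤ) : ℂ) *
          pairProd n (fun _ => c) (fun i => t (Equiv.swap 0 p (e i).succ))) := by
      intro e
      rw [sign_cast, pairProd_succ]
      simp only [Equiv.Perm.decomposeFin_symm_apply_zero, Equiv.Perm.decomposeFin_symm_apply_succ]
      rw [Equiv.prod_comp e (fun k => t p - c * t (Equiv.swap 0 p k.succ))]
      ring
    simp only [hterm]
    rw [← Finset.mul_sum, IH, Finset.prod_div_distrib]
    have hne : ∏ k : Fin n, (t p - t (Equiv.swap 0 p k.succ)) ≠ 0 := by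
      refine Finset.prod_ne_zero_iff.mpr fun k _ => sub_ne_zero.mpr fun h => ?_
      have h1 := ht h
      have : k.succ = 0 := by
        apply (Equiv.swap 0 p).injective
        rw [← h1, Equiv.swap_apply_left]
      exact Fin.succ_ne_zero _ this
    have hsq : ((Equiv.Perm.sign (Equiv.swap 0 p) : ℤ) : ℂ) *
        ((Equiv.Perm.sign (Equiv.swap 0 p) : ℤ) : ℂ) = 1 := by
      rw [← Int.cast_mul, Int.units_coe_mul_self, Int.cast_one]
    field_simp
    linear_combination (((Equiv.Perm.sign (Equiv.swap 0 p) : ℤ) : ℂ) * kConst c n *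
      ∏ k : Fin n, (t p - c * t (Equiv.swap 0 p k.succ))) * hV +
      (kConst c n * (∏ k : Fin n, (t p - c * t (Equiv.swap 0 p k.succ))) *
        pairProd (n + 1) (fun _ => 1) t) * hsq

theorem general (c : ℂ) (hc : c ≠ 1) (f g : ℂ → ℂ) (m : ℕ) : ∀ (n : ℕ) (t : Fin n → ℂ), m ≤ n →
    Function.Injective t → (∀ i, t i ≠ 0) →
    (∀ i j : Fin n, (j : ℕ) = i + 1 → f (t j) = 0 ∨ t j = c * t i) →
    ∑ σ : Equiv.Perm (Fin n), ((Equiv.Perm.sign σ : ℤ) : ℂ) *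
      (∏ i : Fin n, if (i : ℕ) < m then f (t (σ i)) else g (t (σ i))) *
      pairProd n (fun _ => c) (fun i => t (σ i)) =
    kConst c (n - m) * (∏ i : Fin n, if (i : ℕ) < m then f (t i) else g (t i)) *
      pairProd n (fun i => if (i : ℕ) < m then c else 1) t := by
  induction m with
  | zero =>
    intro n t _ ht h0 _
    simp only [Nat.not_lt_zero, if_false, Nat.sub_zero]
    have : ∀ σ : Equiv.Perm (Fin n), ∏ i, g (t (σ i)) = ∏ i, g (t i) := fun σ =>
      Equiv.prod_comp σ (fun i => g (t i))
    simp only [this]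
    have h := antisym c hc n t ht h0
    calc _ = (∏ i, g (t i)) * ∑ σ : Equiv.Perm (Fin n), ((Equiv.Perm.sign σ : ℤ) : ℂ) *
          pairProd n (fun _ => c) (fun i => t (σ i)) := by
            rw [Finset.mul_sum]
            exact Finset.sum_congr rfl fun σ _ => by ring
      _ = _ := by rw [h]; ring
  | succ m ih =>
    intro n t hmn ht h0 hstep
    obtain ⟨n, rfl⟩ : ∃ k, n = k + 1 := ⟨n - 1, by omega⟩
    have IH := ih n (fun i => t i.succ) (by omega) (fun x y h => Fin.succ_injective _ (ht h))
      (fun _ => h0 _) (fun i j hij => hstep i.succ j.succ (by simp [hij]))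
    rw [sum_perm_split, Finset.sum_eq_single 0]
    · have hterm : ∀ e : Equiv.Perm (Fin n),
        ((Equiv.Perm.sign (Equiv.Perm.decomposeFin.symm ((0 : Fin (n + 1)), e)) : ℤ) : ℂ) *
        (∏ i : Fin (n + 1), if (i : ℕ) < m + 1 then
          f (t (Equiv.Perm.decomposeFin.symm ((0 : Fin (n + 1)), e) i))
          else g (t (Equiv.Perm.decomposeFin.symm ((0 : Fin (n + 1)), e) i))) *
          pairProd (n + 1) (fun _ => c)
            (fun i => t (Equiv.Perm.decomposeFin.symm ((0 : Fin (n + 1)), e) i)) =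
        (f (t 0) * ∏ k : Fin n, (t 0 - c * t k.succ)) *
        (((Equiv.Perm.sign e : ℤ) : ℂ) *
          (∏ i : Fin n, if (i : ℕ) < m then f (t (e i).succ) else g (t (e i).succ)) *
          pairProd n (fun _ => c) (fun i => t (e i).succ)) := by
        intro e
        rw [sign_cast, pairProd_succ, Fin.prod_univ_succ]
        simp only [Equiv.Perm.decomposeFin_symm_apply_zero,
          Equiv.Perm.decomposeFin_symm_apply_succ, Equiv.swap_self, Equiv.refl_apply,
          Equiv.Perm.sign_refl, Fin.val_zero, Fin.val_succ, Nat.add_lt_add_iff_right]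
        rw [Equiv.prod_comp e (fun k => t 0 - c * t k.succ)]
        simp
        ring
      simp only [hterm]
      rw [← Finset.mul_sum, IH, pairProd_succ, Fin.prod_univ_succ]
      simp only [Fin.val_zero, Fin.val_succ, Nat.add_lt_add_iff_right, Nat.add_sub_add_right]
      simp
      ring
    · intro p _ hp
      refine Finset.sum_eq_zero fun e _ => ?_
      set σ := Equiv.Perm.decomposeFin.symm (p, e) with hσ
      have hσ0 : σ 0 = p := by simp [hσ]
      have hp0 : (p : ℕ) ≠ 0 := fun h => hp (Fin.ext h)
      have hplt := p.isLt
      let k : Fin (n + 1) := ⟨(p : ℕ) - 1, by omega⟩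
      rcases hstep k p (by simp only [k]; omega) with h | h
      · have : (∏ i : Fin (n + 1), if (i : ℕ) < m + 1 then f (t (σ i)) else g (t (σ i))) = 0 := by
          apply Finset.prod_eq_zero (Finset.mem_univ 0)
          simp [hσ0, h]
        rw [this]; ring
      · have hk : σ.symm k ≠ 0 := by
          intro h'
          have : k = p := by rw [← hσ0, ← h', Equiv.apply_symm_apply]
          have := congrArg Fin.val this
          simp only [k] at this
          omega
        obtain ⟨l, hl⟩ := Fin.exists_succ_eq.mpr hk
        have : pairProd (n + 1) (fun _ => c) (fun i => t (σ i)) = 0 := by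
          rw [pairProd_succ]
          rw [Finset.prod_eq_zero (Finset.mem_univ l), zero_mul]
          rw [hl, Equiv.apply_symm_apply, hσ0, h, sub_self]
        rw [this, mul_zero]
    · simp

theorem phiFun_eq (n s : ℕ) (x₁ x₂ b₂ : ℂ) (t : Fin n → ℂ) :
    phiFun n s x₁ x₂ b₂ t =
      ∏ i : Fin n, if (i : ℕ) < n - s then (1 - b₂ * t i / x₂) else (1 - t i / x₁) := by
  rw [Finset.prod_ite]
  simp only [phiFun, not_lt]

/-- Lemma 8.5: for `r ≤ s`,
`𝒜(φ_s·D_a)(η) = (a⁻¹;a⁻¹)_s/(1−a⁻¹)^s · φ_s(η) ·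
  ∏_{i<j, i≤n−s}(η_i − a⁻¹η_j) · ∏_{n−s+1≤i<j}(η_i − η_j)`. -/
theorem lemma8_5 (n r s : ℕ) (hn : 1 ≤ n) (hrs : r ≤ s) (hs : s ≤ n)
    (x₁ x₂ a b₁ b₂ : ℂ) (hx₁ : x₁ ≠ 0) (hx₂ : x₂ ≠ 0) (ha : a ≠ 0)
    (hb₁ : b₁ ≠ 0) (hb₂ : b₂ ≠ 0)
    (ha1 : ∀ m : ℕ, 1 ≤ m → m ≤ n → a ^ m ≠ 1)
    (hb₁a : ∀ m : ℕ, m ≤ n - 1 → b₁ * a ^ m ≠ 1)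
    (hgen : ∀ m : ℤ, |m| ≤ (n : ℤ) → x₂ * b₁ ≠ x₁ * b₂ * a ^ m)
    (hgen' : ∀ m : ℤ, |m| ≤ (n : ℤ) → x₂ ≠ x₁ * b₂ * a ^ m) :
    ∑ σ : Equiv.Perm (Fin n),
      ((Equiv.Perm.sign σ : ℤ) : ℂ) *
        phiFun n s x₁ x₂ b₂ (fun i => etaPt n r x₁ x₂ a b₁ b₂ (σ i)) *
        ∏ p ∈ Finset.univ.filter (fun p : Fin n × Fin n => p.1 < p.2),
          (etaPt n r x₁ x₂ a b₁ b₂ (σ p.1) - a⁻¹ * etaPt n r x₁ x₂ a b₁ b₂ (σ p.2))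
    = (qPoch a⁻¹ a⁻¹ s / (1 - a⁻¹) ^ s) *
        phiFun n s x₁ x₂ b₂ (etaPt n r x₁ x₂ a b₁ b₂) *
        ∏ p ∈ Finset.univ.filter (fun p : Fin n × Fin n => p.1 < p.2),
          (etaPt n r x₁ x₂ a b₁ b₂ p.1 -
            (if (p.1 : ℕ) < n - s then a⁻¹ else 1) * etaPt n r x₁ x₂ a b₁ b₂ p.2) := by
  have hc : a⁻¹ ≠ 1 := by
    intro h
    exact ha1 1 le_rfl hn (by rw [pow_one]; exact inv_eq_one.mp h)
  have hpow : ∀ i j : ℕ, i < n → j < n → a ^ i = a ^ j → i = j := by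
    have aux : ∀ i j : ℕ, i < j → j < n → a ^ i ≠ a ^ j := by
      intro i j hij hj h
      apply ha1 (j - i) (by omega) (by omega)
      have h2 : a ^ j = a ^ i * a ^ (j - i) := by rw [← pow_add]; congr 1; omega
      rw [h2] at h
      exact (mul_eq_left₀ (pow_ne_zero _ ha)).mp h.symm
    intro i j hi hj h
    rcases lt_trichotomy i j with h' | h' | h'
    · exact absurd h (aux i j h' hj)
    · exact h'
    · exact absurd h.symm (aux j i h' hi)
  have hcross : ∀ i j : ℕ, i < n → j < n →
      x₁ * b₁⁻¹ * (a ^ i)⁻¹ ≠ x₂ * b₂⁻¹ * (a ^ j)⁻¹ := by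
    intro i j hi hj h
    apply hgen ((j : ℤ) - i) (by rw [abs_le]; omega)
    rw [zpow_sub₀ ha, zpow_natCast, zpow_natCast]
    field_simp at h ⊢
    linear_combination -h
  have hinj : Function.Injective (etaPt n r x₁ x₂ a b₁ b₂) := by
    intro i j h
    have hi := i.isLt
    have hj := j.isLt
    unfold etaPt at h
    split_ifs at h with h1 h2 h2
    · have h3 := mul_left_cancel₀ (mul_ne_zero hx₁ (inv_ne_zero hb₁)) h
      exact Fin.ext (hpow _ _ hi hj (inv_injective h3))
    · exact absurd h (hcross _ _ hi (by omega))
    · exact absurd h.symm (hcross _ _ hj (by omega))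
    · have h3 := mul_left_cancel₀ (mul_ne_zero hx₂ (inv_ne_zero hb₂)) h
      have := hpow _ _ (by omega) (by omega) (inv_injective h3)
      exact Fin.ext (by omega)
  have h0 : ∀ i, etaPt n r x₁ x₂ a b₁ b₂ i ≠ 0 := by
    intro i
    unfold etaPt
    split_ifs <;> simp [hx₁, hx₂, hb₁, hb₂, ha]
  have hstep : ∀ i j : Fin n, (j : ℕ) = i + 1 →
      (fun z => 1 - b₂ * z / x₂) (etaPt n r x₁ x₂ a b₁ b₂ j) = 0 ∨
      etaPt n r x₁ x₂ a b₁ b₂ j = a⁻¹ * etaPt n r x₁ x₂ a b₁ b₂ i := by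
    intro i j hij
    by_cases hj : (j : ℕ) < n - r
    · right
      have hi : (i : ℕ) < n - r := by omega
      unfold etaPt
      rw [if_pos hj, if_pos hi, hij, pow_succ, mul_inv]
      ring
    · by_cases hi : (i : ℕ) < n - r
      · left
        have : (j : ℕ) - (n - r) = 0 := by omega
        simp only [etaPt, if_neg hj, this, pow_zero]
        field_simp
        simp
      · right
        have : (j : ℕ) - (n - r) = (i : ℕ) - (n - r) + 1 := by omega
        unfold etaPt
        rw [if_neg hj, if_neg hi, this, pow_succ, mul_inv]
        ring
  have main := general a⁻¹ hc (fun z => 1 - b₂ * z / x₂) (fun z => 1 - z / x₁) (n - s) n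
    (etaPt n r x₁ x₂ a b₁ b₂) (Nat.sub_le _ _) hinj h0 hstep
  rw [Nat.sub_sub_self hs] at main
  simp only [phiFun_eq]
  rw [pairProd_eq n (fun i => if (i : ℕ) < n - s then a⁻¹ else 1)]
  have hp : ∀ σ : Equiv.Perm (Fin n), _ := fun σ =>
    pairProd_eq n (fun _ => a⁻¹) (fun i => etaPt n r x₁ x₂ a b₁ b₂ (σ i))
  simp only [hp]
  exact main
end
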